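/- arXiv:math/0612698 — 2 statements merged into one kernel-verified Lean document; each statement's English description precedes it below -/
import Mathlib

section
/- (Theorem 3.1, convergence in law.) Let N ≥ 1 be an integer, let a : ℝ → ℝ be measurable, nonnegative, vanishing outside (0,2), and integrable, and fix t > 0. Let (h_n) be positive with h_n → 0, τ_n = t/n, and suppose 2τ_n ∫₀² a(α) b(α) R(α) h_n^{−α} dα ≤ 1 for all n. Let ν_n = Σ_{k∈ℤ^N} p_k^{(n)} δ_{h_n k} be the probability measure on ℝ^N of a single jump, where p₀^{(n)} = 1 − 2τ_n Σ_{m≠0} Q_m(h_n)/|m|^N and p_k^{(n)} = 2τ_n Q_k(h_n)/|k|^N for k ≠ 0, and let μ_n = ν_n^{*n} be its n-fold convolution power (the law of the walker's position S_n at time t). If μ is a probability measure on ℝ^N whose characteristic function is ξ ↦ exp(−t ∫₀² a(α)|ξ|^α dα), then μ_n converges weakly (in distribution) to μ as n → ∞. -/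
open MeasureTheory Filter
open scoped Topology ENNReal RealInnerProductSpace

/-- The normalizing constant `b(α)` of the hypersingular integral representation of the
fractional Laplacian `D₀^α = -(-Δ)^{α/2}` in dimension `N`. -/
noncomputable def bConst (N : ℕ) (α : ℝ) : ℝ :=
  α * Real.Gamma (α / 2) * Real.Gamma (((N : ℝ) + α) / 2) * Real.sin (α * Real.pi / 2) /
    (2 ^ ((2 : ℝ) - α) * Real.pi ^ (1 + (N : ℝ) / 2))

/-- Euclidean norm of a lattice point `k ∈ ℤ^N`. -/
noncomputable def latNorm (N : ℕ) (k : Fin N → ℤ) : ℝ :=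
  Real.sqrt (∑ i, ((k i : ℝ)) ^ 2)

/-- The lattice sum `R(α) = ∑_{k ∈ ℤ^N, k ≠ 0} |k|^{-(N+α)}`. -/
noncomputable def Rlat (N : ℕ) (α : ℝ) : ℝ :=
  ∑' k : {k : Fin N → ℤ // k ≠ 0}, latNorm N k.1 ^ (-((N : ℝ) + α))

/-- `Q_m(h) = ∫₀² |m|^{-α} a(α) b(α) h^{-α} dα`. -/
noncomputable def Qcoef (N : ℕ) (a : ℝ → ℝ) (h : ℝ) (m : Fin N → ℤ) : ℝ :=
  ∫ α in (0 : ℝ)..2, latNorm N m ^ (-α) * a α * bConst N α * h ^ (-α)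

/-- The normalization constant `σ(τ,h) = 2τ ∑_{m≠0} Q_m(h)/|m|^N`. -/
noncomputable def sigmaConst (N : ℕ) (a : ℝ → ℝ) (τ h : ℝ) : ℝ :=
  2 * τ * ∑' m : {m : Fin N → ℤ // m ≠ 0}, Qcoef N a h m.1 / latNorm N m.1 ^ (N : ℝ)

/-- The transition probabilities: `p₀ = 1 - σ(τ,h)`, `p_k = 2τ Q_k(h)/|k|^N` for `k ≠ 0`. -/
noncomputable def transProb (N : ℕ) (a : ℝ → ℝ) (τ h : ℝ) (k : Fin N → ℤ) : ℝ :=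
  if k = 0 then 1 - sigmaConst N a τ h else 2 * τ * Qcoef N a h k / latNorm N k ^ (N : ℝ)

/-- The lattice point `k ∈ ℤ^N` viewed as a point of `ℝ^N`. -/
noncomputable def latEmbed (N : ℕ) (k : Fin N → ℤ) : EuclideanSpace ℝ (Fin N) :=
  (WithLp.equiv 2 (Fin N → ℝ)).symm fun i => (k i : ℝ)

/-- The law `ν = ∑_k p_k δ_{h k}` of a single jump of the walker on the lattice `hℤ^N`. -/
noncomputable def jumpLaw (N : ℕ) (a : ℝ → ℝ) (τ h : ℝ) :
    Measure (EuclideanSpace ℝ (Fin N)) :=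
  Measure.sum fun k : Fin N → ℤ =>
    ENNReal.ofReal (transProb N a τ h k) • Measure.dirac (h • latEmbed N k)

/-- The `n`-fold convolution power `ν^{*n}` of a measure (law of the sum of `n` i.i.d. jumps). -/
noncomputable def convPow {E : Type*} [MeasurableSpace E] [AddMonoid E]
    (ν : Measure E) : ℕ → Measure E
  | 0 => Measure.dirac 0
  | n + 1 => (convPow ν n).conv ν


namespace Stmt12

/-- lintegral form of the Gamma integral. -/
lemma lint_gamma {p r : ℝ} (hp : 0 < p) (hr : 0 < r) :
    ∫⁻ s in Set.Ioi (0:ℝ), ENNReal.ofReal (s ^ (p - 1) * Real.exp (-(r * s)))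
      = ENNReal.ofReal (r ^ (-p) * Real.Gamma p) := by
  have h := Real.integral_rpow_mul_exp_neg_mul_Ioi hp hr
  have hG := Real.Gamma_pos_of_pos hp
  have hpos : 0 < (1 / r) ^ p * Real.Gamma p := by positivity
  have hint : IntegrableOn (fun t : ℝ => t ^ (p - 1) * Real.exp (-(r * t))) (Set.Ioi 0) :=
    .of_integral_ne_zero (by rw [h]; exact hpos.ne')
  rw [← ofReal_integral_eq_lintegral_ofReal hint, h]
  · rw [one_div, Real.inv_rpow hr.le, Real.rpow_neg hr.le]
  · filter_upwards [ae_restrict_mem measurableSet_Ioi] with s hs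
    have : 0 < s := hs
    simp only [Pi.zero_apply]; positivity

lemma lint_gamma_inv {β v : ℝ} (hβ1 : β < 1) (hv : 0 < v) :
    ∫⁻ s in Set.Ioi (0:ℝ), ENNReal.ofReal (s ^ (β - 2) * Real.exp (-(v / s)))
      = ENNReal.ofReal (v ^ (β - 1) * Real.Gamma (1 - β)) := by
  have hp : 0 < 1 - β := by linarith
  have h := Real.integral_rpow_mul_exp_neg_mul_Ioi hp hv
  have hG := Real.Gamma_pos_of_pos hp
  have hpos : 0 < (1 / v) ^ (1 - β) * Real.Gamma (1 - β) := by positivity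
  have h2 := integral_comp_rpow_Ioi (fun t : ℝ => t ^ (1 - β - 1) * Real.exp (-(v * t)))
    (p := -1) (by norm_num)
  have h3 : ∫ s in Set.Ioi (0:ℝ), s ^ (β - 2) * Real.exp (-(v / s))
      = (1 / v) ^ (1 - β) * Real.Gamma (1 - β) := by
    rw [← h, ← h2]
    refine setIntegral_congr_fun measurableSet_Ioi fun s hs => ?_
    have hs : 0 < s := hs
    simp only [smul_eq_mul, abs_neg, abs_one, one_mul]
    rw [← Real.rpow_mul hs.le, ← mul_assoc, ← Real.rpow_add hs, Real.rpow_neg_one,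
      div_eq_mul_inv]
    congr 2
    ring
  have hint : IntegrableOn (fun s : ℝ => s ^ (β - 2) * Real.exp (-(v / s))) (Set.Ioi 0) :=
    .of_integral_ne_zero (by rw [h3]; exact hpos.ne')
  rw [← ofReal_integral_eq_lintegral_ofReal hint, h3]
  · rw [one_div, Real.inv_rpow hv.le, ← Real.rpow_neg hv.le, neg_sub]
  · filter_upwards [ae_restrict_mem measurableSet_Ioi] with s hs
    have : 0 < s := hs
    simp only [Pi.zero_apply]; positivity

lemma lint_rpow {β c : ℝ} (hβ0 : 0 < β) (hc : 0 ≤ c) :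
    ∫⁻ v in Set.Ioc (0:ℝ) c, ENNReal.ofReal (v ^ (β - 1)) = ENNReal.ofReal (c ^ β / β) := by
  have h := integral_rpow (a := 0) (b := c) (r := β - 1) (Or.inl (by linarith))
  have hi := intervalIntegral.intervalIntegrable_rpow' (a := 0) (b := c) (r := β - 1) (by linarith)
  rw [intervalIntegral.integral_of_le hc] at h
  rw [intervalIntegrable_iff_integrableOn_Ioc_of_le hc] at hi
  rw [← ofReal_integral_eq_lintegral_ofReal hi, h]
  · rw [sub_add_cancel, Real.zero_rpow hβ0.ne', sub_zero]
  · filter_upwards [ae_restrict_mem measurableSet_Ioc] with s hs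
    have : 0 < s := hs.1
    simp only [Pi.zero_apply]; positivity

lemma lint_exp {s c : ℝ} (hs : 0 < s) (hc : 0 ≤ c) :
    ∫⁻ v in Set.Ioc (0:ℝ) c, ENNReal.ofReal (s⁻¹ * Real.exp (-(v / s)))
      = ENNReal.ofReal (1 - Real.exp (-(c / s))) := by
  have hcont : Continuous fun v : ℝ => s⁻¹ * Real.exp (-(v / s)) := by fun_prop
  have hi := hcont.intervalIntegrable (μ := volume) 0 c
  have h : ∫ v in (0:ℝ)..c, s⁻¹ * Real.exp (-(v / s)) = 1 - Real.exp (-(c / s)) := by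
    have hd : ∀ v ∈ Set.uIcc 0 c,
        HasDerivAt (fun v : ℝ => - Real.exp (-(v / s))) (s⁻¹ * Real.exp (-(v / s))) v := by
      intro v _
      have : HasDerivAt (fun v : ℝ => - Real.exp (-(v / s))) (-(Real.exp (-(v / s)) * -(1 / s))) v :=
        (((hasDerivAt_id v).div_const s).neg.exp).neg
      rwa [show -(Real.exp (-(v / s)) * -(1 / s)) = s⁻¹ * Real.exp (-(v / s)) by ring] at this
    rw [intervalIntegral.integral_eq_sub_of_hasDerivAt hd hi]
    simp; ring
  rw [intervalIntegral.integral_of_le hc] at h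
  rw [intervalIntegrable_iff_integrableOn_Ioc_of_le hc] at hi
  rw [← ofReal_integral_eq_lintegral_ofReal hi, h]
  filter_upwards with s
  simp only [Pi.zero_apply]; positivity

lemma lint_sub {β c : ℝ} (hβ0 : 0 < β) (hβ1 : β < 1) (hc : 0 ≤ c) :
    ∫⁻ s in Set.Ioi (0:ℝ), ENNReal.ofReal (s ^ (β - 1) * (1 - Real.exp (-(c / s))))
      = ENNReal.ofReal (Real.Gamma (1 - β) * c ^ β / β) := by
  have e1 : ∫⁻ s in Set.Ioi (0:ℝ), ENNReal.ofReal (s ^ (β - 1) * (1 - Real.exp (-(c / s))))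
      = ∫⁻ s in Set.Ioi (0:ℝ), ∫⁻ v in Set.Ioc (0:ℝ) c,
        ENNReal.ofReal (s ^ (β - 2) * Real.exp (-(v / s))) := by
    refine setLIntegral_congr_fun measurableSet_Ioi fun s hs => ?_
    have hs : 0 < s := hs
    try simp only
    rw [ENNReal.ofReal_mul (by positivity), ← lint_exp hs hc, ← lintegral_const_mul' _ _ (by simp)]
    refine lintegral_congr fun v => ?_
    rw [← ENNReal.ofReal_mul (by positivity), ← mul_assoc, ← Real.rpow_neg_one s,
      ← Real.rpow_add hs]
    ring_nf
  rw [e1, lintegral_lintegral_swap]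
  · have e2 : ∫⁻ v in Set.Ioc (0:ℝ) c, ∫⁻ s in Set.Ioi (0:ℝ),
        ENNReal.ofReal (s ^ (β - 2) * Real.exp (-(v / s)))
        = ∫⁻ v in Set.Ioc (0:ℝ) c, ENNReal.ofReal (Real.Gamma (1 - β)) *
          ENNReal.ofReal (v ^ (β - 1)) := by
      refine setLIntegral_congr_fun measurableSet_Ioc fun v hv => ?_
      try simp only
      rw [lint_gamma_inv hβ1 hv.1, mul_comm, ENNReal.ofReal_mul]
      exact (Real.Gamma_pos_of_pos (by linarith)).le
    rw [e2, lintegral_const_mul' _ _ (by simp), lint_rpow hβ0 hc, ← ENNReal.ofReal_mul, mul_div_assoc]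
    exact (Real.Gamma_pos_of_pos (by linarith)).le
  · apply Measurable.aemeasurable
    fun_prop

lemma integral_one_sub_cos_gauss {N : ℕ} {s : ℝ} (hs : 0 < s) (ξ : EuclideanSpace ℝ (Fin N)) :
    ∫⁻ x : EuclideanSpace ℝ (Fin N),
      ENNReal.ofReal ((1 - Real.cos ⟪x, ξ⟫) * Real.exp (-(‖x‖ ^ 2 * s)))
      = ENNReal.ofReal ((Real.pi / s) ^ ((N : ℝ) / 2) * (1 - Real.exp (-(‖ξ‖ ^ 2 / 4 / s)))) := by
  have hs' : 0 < ((s : ℂ)).re := by simpa using hs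
  have h1 := GaussianFourier.integral_rexp_neg_mul_sq_norm (V := EuclideanSpace ℝ (Fin N)) hs
  have h2 := GaussianFourier.integral_cexp_neg_mul_sq_norm_add (V := EuclideanSpace ℝ (Fin N)) hs'
    Complex.I ξ
  have i1 : Integrable (fun x : EuclideanSpace ℝ (Fin N) => Real.exp (-s * ‖x‖ ^ 2)) := by
    apply Integrable.of_integral_ne_zero
    rw [h1]; positivity
  have i2 : Integrable (fun x : EuclideanSpace ℝ (Fin N) =>
      Complex.exp (-(s:ℂ) * ‖x‖ ^ 2 + Complex.I * ⟪ξ, x⟫)) := by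
    apply Integrable.of_integral_ne_zero
    rw [h2]
    refine mul_ne_zero ?_ (Complex.exp_ne_zero _)
    rw [Complex.cpow_ne_zero_iff]
    left
    refine div_ne_zero ?_ ?_
    · exact_mod_cast Real.pi_ne_zero
    · exact_mod_cast hs.ne'
  have hre : ∀ x : EuclideanSpace ℝ (Fin N),
      (Complex.exp (-(s:ℂ) * ‖x‖ ^ 2 + Complex.I * ⟪ξ, x⟫)).re
        = Real.exp (-s * ‖x‖ ^ 2) * Real.cos ⟪x, ξ⟫ := by
    intro x
    rw [Complex.exp_re, real_inner_comm]
    have : (-(s:ℂ) * ‖x‖ ^ 2 + Complex.I * ⟪x, ξ⟫) = ((-s * ‖x‖ ^ 2 : ℝ) : ℂ) + ((⟪x, ξ⟫ : ℝ) : ℂ) * Complex.I := by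
      push_cast; ring
    rw [this]
    rw [Complex.add_re, Complex.add_im, Complex.ofReal_re, Complex.ofReal_im, Complex.re_ofReal_mul,
      Complex.im_ofReal_mul]
    simp
  have h3 : ∫ x : EuclideanSpace ℝ (Fin N), Real.exp (-s * ‖x‖ ^ 2) * Real.cos ⟪x, ξ⟫
      = (Real.pi / s) ^ ((N : ℝ) / 2) * Real.exp (-(‖ξ‖ ^ 2 / 4 / s)) := by
    simp_rw [← hre]
    have := integral_re i2
    simp only [RCLike.re_eq_complex_re] at this
    rw [this, h2]
    have e : ((Real.pi / s : ℂ) ^ ((Module.finrank ℝ (EuclideanSpace ℝ (Fin N)) : ℂ) / 2) *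
      Complex.exp (Complex.I ^ 2 * ‖ξ‖ ^ 2 / (4 * s)))
      = (((Real.pi / s) ^ ((N : ℝ) / 2) * Real.exp (-(‖ξ‖ ^ 2 / 4 / s)) : ℝ) : ℂ) := by
      rw [Complex.ofReal_mul, Complex.ofReal_cpow (by positivity)]
      push_cast
      congr 2
      · simp
      · rw [Complex.I_sq]; ring
    rw [e, Complex.ofReal_re]
  have i3 : Integrable (fun x : EuclideanSpace ℝ (Fin N) =>
      Real.exp (-s * ‖x‖ ^ 2) * Real.cos ⟪x, ξ⟫) := by
    have := i2.re
    simpa only [RCLike.re_eq_complex_re, hre] using this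
  have e4 : ∀ x : EuclideanSpace ℝ (Fin N), (1 - Real.cos ⟪x, ξ⟫) * Real.exp (-(‖x‖ ^ 2 * s))
      = Real.exp (-s * ‖x‖ ^ 2) - Real.exp (-s * ‖x‖ ^ 2) * Real.cos ⟪x, ξ⟫ := by
    intro x
    rw [show -(‖x‖ ^ 2 * s) = -s * ‖x‖ ^ 2 by ring]; ring
  simp_rw [e4]
  have i13 : Integrable (fun x : EuclideanSpace ℝ (Fin N) => Real.exp (-s * ‖x‖ ^ 2) -
      Real.exp (-s * ‖x‖ ^ 2) * Real.cos ⟪x, ξ⟫) := i1.sub i3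
  rw [← ofReal_integral_eq_lintegral_ofReal i13, integral_sub i1 i3, h1, h3]
  · congr 1
    rw [finrank_euclideanSpace, Fintype.card_fin]; ring
  · filter_upwards with x
    rw [← e4]
    have := Real.cos_le_one ⟪x, ξ⟫
    have h0 : 0 ≤ 1 - Real.cos ⟪x, ξ⟫ := by linarith
    simp only [Pi.zero_apply]; positivity

lemma kernel_exact {N : ℕ} {α : ℝ} (h0 : 0 < α) (h2 : α < 2) (ξ : EuclideanSpace ℝ (Fin N)) :
    ENNReal.ofReal (bConst N α) * ∫⁻ x : EuclideanSpace ℝ (Fin N),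
      ENNReal.ofReal ((1 - Real.cos ⟪x, ξ⟫) * ‖x‖ ^ (-((N : ℝ) + α)))
      = ENNReal.ofReal (‖ξ‖ ^ α / 2) := by
  set p : ℝ := ((N : ℝ) + α) / 2 with hp
  have hp0 : 0 < p := by positivity
  have hG := Real.Gamma_pos_of_pos hp0
  have hcos : ∀ x : EuclideanSpace ℝ (Fin N), 0 ≤ 1 - Real.cos ⟪x, ξ⟫ := fun x => by
    have := Real.cos_le_one ⟪x, ξ⟫
    linarith
  have key : ENNReal.ofReal (Real.Gamma p) * ∫⁻ x : EuclideanSpace ℝ (Fin N),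
      ENNReal.ofReal ((1 - Real.cos ⟪x, ξ⟫) * ‖x‖ ^ (-((N : ℝ) + α)))
      = ENNReal.ofReal (Real.pi ^ ((N : ℝ) / 2) *
        (Real.Gamma (1 - α / 2) * (‖ξ‖ ^ 2 / 4) ^ (α / 2) / (α / 2))) := by
    rw [← lintegral_const_mul' _ _ (by simp)]
    have e1 : ∀ x : EuclideanSpace ℝ (Fin N), ENNReal.ofReal (Real.Gamma p) *
        ENNReal.ofReal ((1 - Real.cos ⟪x, ξ⟫) * ‖x‖ ^ (-((N : ℝ) + α)))
        = ∫⁻ s in Set.Ioi (0:ℝ), ENNReal.ofReal (s ^ (p - 1) *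
          ((1 - Real.cos ⟪x, ξ⟫) * Real.exp (-(‖x‖ ^ 2 * s)))) := by
      intro x
      rcases eq_or_ne x 0 with rfl | hx
      · simp
      have hx : 0 < ‖x‖ := norm_pos_iff.mpr hx
      have e : ∀ s : ℝ, ENNReal.ofReal (s ^ (p - 1) *
          ((1 - Real.cos ⟪x, ξ⟫) * Real.exp (-(‖x‖ ^ 2 * s)))) = ENNReal.ofReal (1 - Real.cos ⟪x, ξ⟫) *
          ENNReal.ofReal (s ^ (p - 1) * Real.exp (-(‖x‖ ^ 2 * s))) := by
        intro s
        rw [← ENNReal.ofReal_mul (hcos x)]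
        ring_nf
      simp_rw [e]
      rw [lintegral_const_mul' _ _ (by simp), lint_gamma hp0 (by positivity), ← ENNReal.ofReal_mul hG.le,
        ← ENNReal.ofReal_mul (hcos x), ← Real.rpow_natCast, ← Real.rpow_mul hx.le]
      congr 1
      rw [show ((2:ℕ):ℝ) * -p = -((N:ℝ) + α) by rw [hp]; push_cast; ring]
      ring
    simp_rw [e1]
    rw [lintegral_lintegral_swap]
    · have e2 : ∫⁻ s in Set.Ioi (0:ℝ), ∫⁻ x : EuclideanSpace ℝ (Fin N), ENNReal.ofReal (s ^ (p - 1) *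
          ((1 - Real.cos ⟪x, ξ⟫) * Real.exp (-(‖x‖ ^ 2 * s))))
          = ∫⁻ s in Set.Ioi (0:ℝ), ENNReal.ofReal (Real.pi ^ ((N : ℝ) / 2)) *
            ENNReal.ofReal (s ^ (α / 2 - 1) * (1 - Real.exp (-(‖ξ‖ ^ 2 / 4 / s)))) := by
        refine setLIntegral_congr_fun measurableSet_Ioi fun s hs => ?_
        have hs : 0 < s := hs
        have hs1 : 0 ≤ s ^ (p - 1) := by positivity
        try simp only
        simp_rw [ENNReal.ofReal_mul hs1]
        rw [lintegral_const_mul' _ _ (by simp), integral_one_sub_cos_gauss hs,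
          ← ENNReal.ofReal_mul hs1, ← ENNReal.ofReal_mul (by positivity)]
        congr 1
        rw [Real.div_rpow Real.pi_pos.le hs.le]
        have : s ^ (p - 1) = s ^ (α / 2 - 1) * s ^ ((N : ℝ) / 2) := by
          rw [← Real.rpow_add hs]; congr 1; rw [hp]; ring
        rw [this]
        have : s ^ ((N : ℝ) / 2) ≠ 0 := by positivity
        field_simp
      rw [e2, lintegral_const_mul' _ _ (by simp), lint_sub (by positivity) (by linarith) (by positivity),
        ← ENNReal.ofReal_mul (by positivity)]
    · apply Measurable.aemeasurable
      fun_prop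
  have hsplit : bConst N α = (α * Real.Gamma (α / 2) * Real.sin (α * Real.pi / 2) /
    (2 ^ ((2 : ℝ) - α) * Real.pi ^ (1 + (N : ℝ) / 2))) * Real.Gamma p := by
    rw [bConst]; ring
  have hsin : 0 < Real.sin (α * Real.pi / 2) := by
    apply Real.sin_pos_of_pos_of_lt_pi
    · positivity
    · nlinarith [Real.pi_pos]
  have hG1 : 0 < Real.Gamma (α / 2) := Real.Gamma_pos_of_pos (by positivity)
  have hpre : 0 ≤ α * Real.Gamma (α / 2) * Real.sin (α * Real.pi / 2) /
    (2 ^ ((2 : ℝ) - α) * Real.pi ^ (1 + (N : ℝ) / 2)) := by positivity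
  rw [hsplit, ENNReal.ofReal_mul hpre, mul_assoc, key, ← ENNReal.ofReal_mul hpre]
  congr 1
  have hrefl := Real.Gamma_mul_Gamma_one_sub (α / 2)
  rw [show Real.pi * (α / 2) = α * Real.pi / 2 by ring] at hrefl
  have e5 : (‖ξ‖ ^ 2 / 4) ^ (α / 2) = ‖ξ‖ ^ α / 2 ^ α := by
    rw [show ‖ξ‖ ^ 2 / 4 = (‖ξ‖ / 2) ^ (2:ℕ) by ring, ← Real.rpow_natCast, ← Real.rpow_mul (by positivity),
      Real.div_rpow (by positivity) (by positivity)]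
    congr 2 <;> (push_cast; ring)
  rw [e5, Real.rpow_sub (by norm_num), Real.rpow_add Real.pi_pos, Real.rpow_one]
  have h2a : (2:ℝ) ^ α ≠ 0 := by positivity
  have hpi : Real.pi ^ ((N : ℝ) / 2) ≠ 0 := by positivity
  have hpi' := Real.pi_ne_zero
  rw [eq_div_iff hsin.ne'] at hrefl
  rw [show (2:ℝ) ^ (2:ℝ) = 4 by norm_num]
  field_simp
  have : Real.Gamma ((2 - α) / 2) = Real.Gamma (1 - α / 2) := by congr 1; ring
  try rw [this]
  linear_combination (4 * ‖ξ‖ ^ α) * hrefl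


lemma gamma_cont {x : ℝ} (hx : 0 < x) : ContinuousAt Real.Gamma x := by
  refine (Real.differentiableAt_Gamma (fun m => ?_)).continuousAt
  have : (0:ℝ) ≤ m := Nat.cast_nonneg m
  linarith

lemma bConst_pos {N : ℕ} {α : ℝ} (hα : α ∈ Set.Ioo (0:ℝ) 2) : 0 < bConst N α := by
  obtain ⟨h0, h2⟩ := hα
  have hsin : 0 < Real.sin (α * Real.pi / 2) := by
    apply Real.sin_pos_of_pos_of_lt_pi
    · positivity
    · nlinarith [Real.pi_pos]
  have hG1 : 0 < Real.Gamma (α / 2) := Real.Gamma_pos_of_pos (by positivity)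
  have hG2 : 0 < Real.Gamma (((N:ℝ) + α) / 2) := Real.Gamma_pos_of_pos (by positivity)
  unfold bConst
  positivity

/-- the regular part of `bConst` -/
noncomputable def bReg (N : ℕ) (α : ℝ) : ℝ :=
  2 * Real.Gamma (1 + α / 2) * Real.Gamma (((N : ℝ) + α) / 2) /
    (2 ^ ((2 : ℝ) - α) * Real.pi ^ (1 + (N : ℝ) / 2))

lemma bReg_cont {N : ℕ} (hN : 1 ≤ N) : ContinuousOn (bReg N) (Set.Icc 0 2) := by
  intro α hα
  apply ContinuousAt.continuousWithinAt
  have hN' : (1:ℝ) ≤ N := by exact_mod_cast hN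
  have h1 : ContinuousAt (fun α : ℝ => Real.Gamma (1 + α / 2)) α :=
    ContinuousAt.comp (f := fun α : ℝ => 1 + α / 2) (g := Real.Gamma)
      (gamma_cont (by linarith [hα.1])) (by fun_prop)
  have h2 : ContinuousAt (fun α : ℝ => Real.Gamma (((N:ℝ) + α) / 2)) α :=
    ContinuousAt.comp (f := fun α : ℝ => ((N:ℝ) + α) / 2) (g := Real.Gamma)
      (gamma_cont (by linarith [hα.1])) (by fun_prop)
  have h3 : ContinuousAt (fun α : ℝ => (2:ℝ) ^ ((2 : ℝ) - α) * Real.pi ^ (1 + (N : ℝ) / 2)) α := by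
    apply ContinuousAt.mul _ continuousAt_const
    exact (Real.continuous_const_rpow (by norm_num)).continuousAt.comp (by fun_prop)
  exact ((continuousAt_const.mul h1).mul h2).div h3 (by positivity)

lemma bConst_eq {N : ℕ} {α : ℝ} (hα : α ≠ 0) :
    bConst N α = bReg N α * Real.sin (α * Real.pi / 2) := by
  unfold bConst bReg
  rw [add_comm 1 (α / 2), Real.Gamma_add_one (by positivity)]
  ring

lemma bConst_cont {N : ℕ} (hN : 1 ≤ N) : ContinuousOn (bConst N) (Set.Ioo 0 2) := by
  have : ContinuousOn (fun α => bReg N α * Real.sin (α * Real.pi / 2)) (Set.Ioo 0 2) :=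
    ((bReg_cont hN).mono Set.Ioo_subset_Icc_self).mul (by fun_prop)
  exact this.congr fun α hα => bConst_eq hα.1.ne'

lemma bConst_bound {N : ℕ} (hN : 1 ≤ N) :
    ∃ C : ℝ, 0 ≤ C ∧ ∀ α ∈ Set.Ioo (0:ℝ) 2, bConst N α ≤ C * (α * (2 - α)) := by
  obtain ⟨C, hC⟩ := isCompact_Icc.exists_bound_of_continuousOn (bReg_cont hN)
  have hC0 : 0 ≤ C := (norm_nonneg _).trans (hC 0 (by simp))
  refine ⟨C * (Real.pi / 2), by positivity, fun α hα => ?_⟩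
  rw [bConst_eq hα.1.ne', mul_assoc]
  obtain ⟨h0, h2⟩ := hα
  have hpi := Real.pi_pos
  have hsin0 : 0 ≤ Real.sin (α * Real.pi / 2) :=
    Real.sin_nonneg_of_nonneg_of_le_pi (by positivity) (by nlinarith)
  have hsin : Real.sin (α * Real.pi / 2) ≤ Real.pi / 2 * (α * (2 - α)) := by
    rcases le_total α 1 with h | h
    · have := Real.sin_le (x := α * Real.pi / 2) (by positivity)
      have h3 : α ≤ α * (2 - α) := by nlinarith
      nlinarith
    · rw [← Real.sin_pi_sub]
      have := Real.sin_le (x := Real.pi - α * Real.pi / 2) (by nlinarith)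
      have h3 : 2 - α ≤ α * (2 - α) := by nlinarith
      nlinarith
  have := hC α ⟨h0.le, h2.le⟩
  rw [Real.norm_eq_abs] at this
  exact mul_le_mul ((le_abs_self _).trans this) hsin hsin0 hC0

lemma kernel_dom {N : ℕ} (hN : 1 ≤ N) :
    ∃ C : ℝ, 0 ≤ C ∧ ∀ α ∈ Set.Ioo (0:ℝ) 2,
      ∫⁻ x : EuclideanSpace ℝ (Fin N),
        ENNReal.ofReal (‖x‖ ^ (-((N : ℝ) + α)) * min 1 (‖x‖ ^ 2))
      ≤ ENNReal.ofReal (C / (α * (2 - α))) := by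
  have : Nonempty (Fin N) := ⟨⟨0, hN⟩⟩
  have : Nontrivial (EuclideanSpace ℝ (Fin N)) := inferInstance
  set V : ℝ := (N : ℝ) * (volume : Measure (EuclideanSpace ℝ (Fin N))).real (Metric.ball 0 1) with hV
  have hV0 : 0 ≤ V := by positivity
  refine ⟨V * 2, by positivity, fun α hα => ?_⟩
  obtain ⟨h0, h2⟩ := hα
  set f : ℝ → ℝ := fun y => y ^ (-((N : ℝ) + α)) * min 1 (y ^ 2) with hf
  have e1 : ∀ y ∈ Set.Ioc (0:ℝ) 1, y ^ (N - 1) • f y = y ^ (1 - α) := by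
    intro y hy
    have hy0 := hy.1
    simp only [hf, smul_eq_mul]
    rw [min_eq_right (by nlinarith [hy.2]), ← mul_assoc, ← Real.rpow_natCast, ← Real.rpow_natCast,
      ← Real.rpow_add hy0, ← Real.rpow_add hy0]
    congr 1
    push_cast [Nat.cast_sub hN]; ring
  have e2 : ∀ y ∈ Set.Ioi (1:ℝ), y ^ (N - 1) • f y = y ^ (-1 - α) := by
    intro y hy
    have hy1 : 1 < y := hy
    have hy0 : 0 < y := by linarith
    simp only [hf, smul_eq_mul]
    rw [min_eq_left (by nlinarith), mul_one, ← Real.rpow_natCast, ← Real.rpow_add hy0]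
    congr 1
    push_cast [Nat.cast_sub hN]; ring
  have i1 : IntegrableOn (fun y : ℝ => y ^ (N - 1) • f y) (Set.Ioc 0 1) := by
    have := intervalIntegral.intervalIntegrable_rpow' (a := 0) (b := 1) (r := 1 - α) (by linarith)
    rw [intervalIntegrable_iff_integrableOn_Ioc_of_le zero_le_one] at this
    exact this.congr_fun (fun y hy => (e1 y hy).symm) measurableSet_Ioc
  have i2 : IntegrableOn (fun y : ℝ => y ^ (N - 1) • f y) (Set.Ioi 1) := by
    have := integrableOn_Ioi_rpow_of_lt (a := -1 - α) (c := 1) (by linarith) one_pos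
    exact this.congr_fun (fun y hy => (e2 y hy).symm) measurableSet_Ioi
  have hU : Set.Ioc (0:ℝ) 1 ∪ Set.Ioi 1 = Set.Ioi 0 := Set.Ioc_union_Ioi_eq_Ioi zero_le_one
  have hfr : Module.finrank ℝ (EuclideanSpace ℝ (Fin N)) = N := by simp
  have i3 : Integrable (fun x : EuclideanSpace ℝ (Fin N) => f ‖x‖) := by
    rw [integrable_fun_norm_addHaar, hfr, ← hU]
    exact i1.union i2
  have hval : ∫ x : EuclideanSpace ℝ (Fin N), f ‖x‖ = V * 2 / (α * (2 - α)) := by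
    rw [integral_fun_norm_addHaar, hfr, ← hU, setIntegral_union _ measurableSet_Ioi i1 i2,
      setIntegral_congr_fun measurableSet_Ioc e1, setIntegral_congr_fun measurableSet_Ioi e2,
      integral_Ioi_rpow_of_lt (by linarith) one_pos, ← intervalIntegral.integral_of_le zero_le_one,
      integral_rpow (Or.inl (by linarith))]
    · rw [hV, Real.zero_rpow (by linarith)]
      simp only [Real.one_rpow, nsmul_eq_mul, smul_eq_mul]
      have h3 : 1 - α + 1 ≠ 0 := by linarith
      have h4 : -1 - α + 1 ≠ 0 := by linarith
      have h5 : 2 - α ≠ 0 := by linarith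
      have h6 : (1 - 0) / (1 - α + 1) + -1 / (-1 - α + 1) = 2 / (α * (2 - α)) := by
        rw [show 1 - α + 1 = 2 - α by ring, show -1 - α + 1 = -α by ring, neg_div_neg_eq]
        field_simp; ring
      rw [h6]; ring
    · rw [Set.disjoint_left]; rintro y hy hy'
      exact absurd hy.2 (not_le.mpr hy')
  rw [← hval, ofReal_integral_eq_lintegral_ofReal i3]
  filter_upwards with x
  simp only [Pi.zero_apply, hf]; positivity


/-- coordinatewise rounding to the lattice -/
noncomputable def rnd (N : ℕ) (h : ℝ) (x : EuclideanSpace ℝ (Fin N)) : Fin N → ℤ :=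
  fun i => round (x i / h)

/-- nearest point of the scaled lattice -/
noncomputable def gr (N : ℕ) (h : ℝ) (x : EuclideanSpace ℝ (Fin N)) : EuclideanSpace ℝ (Fin N) :=
  h • latEmbed N (rnd N h x)

lemma latEmbed_apply {N : ℕ} (k : Fin N → ℤ) (i : Fin N) : latEmbed N k i = (k i : ℝ) := rfl

lemma gr_apply {N : ℕ} {h : ℝ} (x : EuclideanSpace ℝ (Fin N)) (i : Fin N) :
    gr N h x i = h * (round (x i / h) : ℝ) := rfl

lemma norm_latEmbed {N : ℕ} (k : Fin N → ℤ) : ‖latEmbed N k‖ = latNorm N k := by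
  rw [EuclideanSpace.norm_eq, latNorm]
  congr 1
  refine Finset.sum_congr rfl fun i _ => ?_
  rw [latEmbed_apply, Real.norm_eq_abs, sq_abs]

lemma measurable_rnd {N : ℕ} {h : ℝ} : Measurable (rnd N h) := by
  refine measurable_pi_lambda _ fun i => ?_
  have : Measurable fun x : EuclideanSpace ℝ (Fin N) => ⌊x i / h + 1 / 2⌋ := by
    apply Measurable.floor
    fun_prop
  simpa only [rnd, round_eq] using this

lemma volume_fibre {N : ℕ} {h : ℝ} (hh : 0 < h) (m : Fin N → ℤ) :
    volume (rnd N h ⁻¹' {m}) = ENNReal.ofReal (h ^ N) := by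
  have hset : rnd N h ⁻¹' {m} = (WithLp.ofLp : EuclideanSpace ℝ (Fin N) → (Fin N → ℝ)) ⁻¹'
      (Set.pi Set.univ fun i => Set.Ico (h * (m i - 1 / 2)) (h * (m i + 1 / 2))) := by
    ext x
    simp only [Set.mem_preimage, Set.mem_singleton_iff, Set.mem_pi, Set.mem_univ, true_imp_iff,
      Set.mem_Ico, funext_iff, rnd]
    refine forall_congr' fun i => ?_
    rw [round_eq, Int.floor_eq_iff]
    constructor
    · rintro ⟨h1, h2⟩
      have h1' : (m i : ℝ) - 1 / 2 ≤ x i / h := by linarith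
      have h2' : x i / h < (m i : ℝ) + 1 / 2 := by linarith
      rw [le_div_iff₀ hh] at h1'
      rw [div_lt_iff₀ hh] at h2'
      constructor <;> linarith
    · rintro ⟨h1, h2⟩
      have h1' : (m i : ℝ) - 1 / 2 ≤ x i / h := by rw [le_div_iff₀ hh]; linarith
      have h2' : x i / h < (m i : ℝ) + 1 / 2 := by rw [div_lt_iff₀ hh]; linarith
      constructor <;> linarith
  rw [hset, (PiLp.volume_preserving_ofLp (Fin N)).measure_preimage, Real.volume_pi_Ico]
  · have : ∀ i, h * ((m i : ℝ) + 1 / 2) - h * ((m i : ℝ) - 1 / 2) = h := fun i => by ring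
    simp_rw [this]
    rw [Finset.prod_const, Finset.card_univ, Fintype.card_fin, ENNReal.ofReal_pow hh.le]
  · exact (MeasurableSet.univ_pi fun i => measurableSet_Ico).nullMeasurableSet

lemma riemann {N : ℕ} {h : ℝ} (hh : 0 < h) (g : EuclideanSpace ℝ (Fin N) → ℝ≥0∞) :
    ∫⁻ x, g (gr N h x) = ∑' m : Fin N → ℤ, ENNReal.ofReal (h ^ N) * g (h • latEmbed N m) := by
  have h1 : ∫⁻ x, g (gr N h x) = ∫⁻ m, g (h • latEmbed N m) ∂(Measure.map (rnd N h) volume) := by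
    rw [lintegral_map (measurable_of_countable _) measurable_rnd]
    rfl
  rw [h1, lintegral_countable']
  refine tsum_congr fun m => ?_
  rw [Measure.map_apply measurable_rnd (measurableSet_singleton m), volume_fibre hh, mul_comm]

lemma coord_le_norm {N : ℕ} (x : EuclideanSpace ℝ (Fin N)) (i : Fin N) : |x i| ≤ ‖x‖ := by
  simpa using PiLp.norm_apply_le x i

lemma gr_close {N : ℕ} {h : ℝ} (hh : 0 < h) (x : EuclideanSpace ℝ (Fin N)) :
    ‖gr N h x - x‖ ≤ N * (h / 2) := by
  have hc : ∀ i, |(gr N h x - x) i| ≤ h / 2 := by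
    intro i
    have h1 := abs_sub_round (x i / h)
    have h2 : (gr N h x - x) i = - (h * (x i / h - round (x i / h))) := by
      rw [PiLp.sub_apply, gr_apply]; field_simp; ring
    rw [h2, abs_neg, abs_mul, abs_of_pos hh]
    nlinarith
  rw [EuclideanSpace.norm_eq]
  apply Real.sqrt_le_iff.mpr
  refine ⟨by positivity, ?_⟩
  calc ∑ i, ‖(gr N h x - x) i‖ ^ 2 ≤ ∑ i : Fin N, (h / 2) ^ 2 := by
        refine Finset.sum_le_sum fun i _ => ?_
        rw [Real.norm_eq_abs]
        exact pow_le_pow_left₀ (abs_nonneg _) (hc i) 2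
    _ = N * (h / 2) ^ 2 := by simp
    _ ≤ (N * (h / 2)) ^ 2 := by
        rw [mul_pow]
        have : (N : ℝ) ≤ (N : ℝ) ^ 2 := by exact_mod_cast Nat.le_self_pow two_ne_zero N
        exact mul_le_mul_of_nonneg_right this (by positivity)

lemma gr_compare {N : ℕ} {h : ℝ} (hh : 0 < h) (x : EuclideanSpace ℝ (Fin N)) (hne : gr N h x ≠ 0) :
    h ≤ 2 * ‖x‖ ∧ ‖gr N h x‖ ≤ (1 + N) * ‖x‖ ∧ ‖x‖ ≤ (1 + N) * ‖gr N h x‖ := by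
  obtain ⟨i, hi⟩ : ∃ i, round (x i / h) ≠ 0 := by
    by_contra! hcon
    apply hne
    ext i
    rw [gr_apply, hcon i]; simp
  have habs : (1:ℝ) ≤ |(round (x i / h) : ℝ)| := by
    exact_mod_cast Int.one_le_abs hi
  have hy : h ≤ ‖gr N h x‖ := by
    refine le_trans ?_ (coord_le_norm _ i)
    rw [gr_apply, abs_mul, abs_of_pos hh]
    nlinarith
  have hx : h ≤ 2 * ‖x‖ := by
    have h1 := abs_sub_round (x i / h)
    have h2 : (1:ℝ) / 2 ≤ |x i / h| := by
      have := abs_sub_abs_le_abs_sub ((round (x i / h) : ℝ)) (x i / h)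
      rw [abs_sub_comm] at this
      linarith
    rw [abs_div, abs_of_pos hh, le_div_iff₀ hh] at h2
    have := coord_le_norm x i
    linarith
  have hc := gr_close hh x
  have h3 := norm_sub_norm_le (gr N h x) x
  have h4 := norm_sub_norm_le x (gr N h x)
  rw [norm_sub_rev] at h4
  have hN0 : (0:ℝ) ≤ N := Nat.cast_nonneg N
  refine ⟨hx, ?_, ?_⟩
  · nlinarith
  · nlinarith

lemma gr_tendsto {N : ℕ} {h : ℕ → ℝ} (hh : ∀ n, 0 < h n) (h0 : Tendsto h atTop (𝓝 0))
    (x : EuclideanSpace ℝ (Fin N)) : Tendsto (fun n => gr N (h n) x) atTop (𝓝 x) := by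
  rw [tendsto_iff_norm_sub_tendsto_zero]
  refine squeeze_zero (fun n => norm_nonneg _) (fun n => gr_close (hh n) x) ?_
  have := (h0.div_const 2).const_mul (N : ℝ)
  simpa using this

lemma rpow_compare {N : ℕ} {α u v : ℝ} (hα : α ∈ Set.Ioo (0:ℝ) 2) (hu : 0 < u) (hv : 0 < v)
    (huv : v ≤ (1 + N) * u) :
    u ^ (-((N : ℝ) + α)) ≤ (1 + (N:ℝ)) ^ ((N : ℝ) + 2) * v ^ (-((N : ℝ) + α)) := by
  have hA : (1:ℝ) ≤ 1 + N := by simp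
  have h0 := hα.1
  have h2 := hα.2
  have h1 : v / (1 + N) ≤ u := by rw [div_le_iff₀ (by positivity)]; linarith
  calc u ^ (-((N : ℝ) + α)) ≤ (v / (1 + N)) ^ (-((N : ℝ) + α)) :=
        Real.rpow_le_rpow_of_nonpos (by positivity) h1 (by
          have : (0:ℝ) ≤ N := Nat.cast_nonneg N
          linarith)
    _ = (1 + (N:ℝ)) ^ ((N : ℝ) + α) * v ^ (-((N : ℝ) + α)) := by
        rw [Real.div_rpow hv.le (by positivity), Real.rpow_neg (by positivity) (x := 1 + (N:ℝ)),
          div_inv_eq_mul, mul_comm]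
    _ ≤ _ := by
        gcongr

lemma one_sub_cos_le (y ξ : ℝ) (hy : 0 ≤ y) (z : ℝ) (hz : |z| ≤ y * ξ) :
    1 - Real.cos z ≤ (2 + ξ ^ 2) * min 1 (y ^ 2) := by
  have h1 := Real.neg_one_le_cos z
  have h2 := Real.one_sub_sq_div_two_le_cos (x := z)
  have h3 : z ^ 2 ≤ (y * ξ) ^ 2 := by
    rw [← sq_abs]; exact pow_le_pow_left₀ (abs_nonneg _) hz 2
  rcases le_total 1 (y ^ 2) with h | h
  · rw [min_eq_left h]; nlinarith [sq_nonneg ξ]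
  · rw [min_eq_right h]; nlinarith [sq_nonneg ξ, sq_nonneg y, mul_pow y ξ 2]

/-- the kernel -/
noncomputable def ker (N : ℕ) (ξ : EuclideanSpace ℝ (Fin N)) (α : ℝ)
    (y : EuclideanSpace ℝ (Fin N)) : ℝ :=
  (1 - Real.cos ⟪y, ξ⟫) * ‖y‖ ^ (-((N : ℝ) + α))

lemma ker_nonneg {N : ℕ} (ξ : EuclideanSpace ℝ (Fin N)) (α : ℝ) (y : EuclideanSpace ℝ (Fin N)) :
    0 ≤ ker N ξ α y := by
  have := Real.cos_le_one ⟪y, ξ⟫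
  have h0 : 0 ≤ 1 - Real.cos ⟪y, ξ⟫ := by linarith
  unfold ker; positivity

lemma ker_gr_le {N : ℕ} {h : ℝ} (hh : 0 < h) (ξ : EuclideanSpace ℝ (Fin N)) {α : ℝ}
    (hα : α ∈ Set.Ioo (0:ℝ) 2) (x : EuclideanSpace ℝ (Fin N)) :
    ker N ξ α (gr N h x) ≤ ((2 + ‖ξ‖ ^ 2) * (1 + (N:ℝ)) ^ 2 * (1 + (N:ℝ)) ^ ((N : ℝ) + 2)) *
      (‖x‖ ^ (-((N : ℝ) + α)) * min 1 (‖x‖ ^ 2)) := by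
  by_cases hne : gr N h x = 0
  · rw [hne]
    have : ker N ξ α 0 = 0 := by simp [ker]
    rw [this]; positivity
  obtain ⟨h1, h2, h3⟩ := gr_compare hh x hne
  have hx : 0 < ‖x‖ := by linarith
  have hy : 0 < ‖gr N h x‖ := norm_pos_iff.mpr hne
  have hA : (1:ℝ) ≤ 1 + N := by simp
  have hr := rpow_compare hα hy hx h3
  have hcs := one_sub_cos_le ‖gr N h x‖ ‖ξ‖ hy.le _ (abs_real_inner_le_norm (gr N h x) ξ)
  have hmin : min 1 (‖gr N h x‖ ^ 2) ≤ (1 + (N:ℝ)) ^ 2 * min 1 (‖x‖ ^ 2) := by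
    rw [mul_min_of_nonneg _ _ (by positivity)]
    apply min_le_min
    · nlinarith
    · rw [← mul_pow]; exact pow_le_pow_left₀ hy.le h2 2
  calc ker N ξ α (gr N h x) ≤ ((2 + ‖ξ‖ ^ 2) * ((1 + (N:ℝ)) ^ 2 * min 1 (‖x‖ ^ 2))) *
        ((1 + (N:ℝ)) ^ ((N : ℝ) + 2) * ‖x‖ ^ (-((N : ℝ) + α))) := by
        unfold ker
        refine mul_le_mul (hcs.trans ?_) hr (by positivity) (by positivity)
        exact mul_le_mul_of_nonneg_left hmin (by positivity)
    _ = _ := by ring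

/-- the discretised symbol -/
noncomputable def Fh (N : ℕ) (ξ : EuclideanSpace ℝ (Fin N)) (h α : ℝ) : ℝ≥0∞ :=
  ∑' m : Fin N → ℤ, ENNReal.ofReal (h ^ N) * ENNReal.ofReal (ker N ξ α (h • latEmbed N m))

lemma Fh_eq {N : ℕ} {h : ℝ} (hh : 0 < h) (ξ : EuclideanSpace ℝ (Fin N)) (α : ℝ) :
    Fh N ξ h α = ∫⁻ x, ENNReal.ofReal (ker N ξ α (gr N h x)) :=
  (riemann hh (fun y => ENNReal.ofReal (ker N ξ α y))).symm

lemma measurable_Fh {N : ℕ} {h : ℝ} (ξ : EuclideanSpace ℝ (Fin N)) : Measurable (Fh N ξ h) := by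
  unfold Fh
  refine Measurable.ennreal_tsum fun m => ?_
  unfold ker
  fun_prop

lemma measurable_gr {N : ℕ} {h : ℝ} : Measurable (gr N h) :=
  (measurable_of_countable (fun m : Fin N → ℤ => h • latEmbed N m)).comp measurable_rnd

lemma measurable_ker {N : ℕ} (ξ : EuclideanSpace ℝ (Fin N)) (α : ℝ) : Measurable (ker N ξ α) := by
  unfold ker; fun_prop

lemma Fh_le {N : ℕ} (hN : 1 ≤ N) (ξ : EuclideanSpace ℝ (Fin N)) :
    ∃ C : ℝ, 0 ≤ C ∧ ∀ h : ℝ, 0 < h → ∀ α ∈ Set.Ioo (0:ℝ) 2,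
      Fh N ξ h α ≤ ENNReal.ofReal (C / (α * (2 - α))) := by
  obtain ⟨C, hC0, hC⟩ := kernel_dom hN
  set M : ℝ := ((2 + ‖ξ‖ ^ 2) * (1 + (N:ℝ)) ^ 2 * (1 + (N:ℝ)) ^ ((N : ℝ) + 2)) with hM
  have hM0 : 0 ≤ M := by positivity
  refine ⟨M * C, by positivity, fun h hh α hα => ?_⟩
  rw [Fh_eq hh]
  calc ∫⁻ x, ENNReal.ofReal (ker N ξ α (gr N h x))
      ≤ ∫⁻ x : EuclideanSpace ℝ (Fin N), ENNReal.ofReal M * ENNReal.ofReal (‖x‖ ^ (-((N : ℝ) + α)) * min 1 (‖x‖ ^ 2)) := by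
        refine lintegral_mono fun x => ?_
        rw [← ENNReal.ofReal_mul hM0]
        exact ENNReal.ofReal_le_ofReal (ker_gr_le hh ξ hα x)
    _ ≤ ENNReal.ofReal M * ENNReal.ofReal (C / (α * (2 - α))) := by
        rw [lintegral_const_mul' _ _ (by simp)]
        gcongr
        exact hC α hα
    _ = _ := by rw [← ENNReal.ofReal_mul hM0, mul_div_assoc]

lemma Fh_tendsto {N : ℕ} (hN : 1 ≤ N) (ξ : EuclideanSpace ℝ (Fin N)) {h : ℕ → ℝ} (hh : ∀ n, 0 < h n)
    (h0 : Tendsto h atTop (𝓝 0)) {α : ℝ} (hα : α ∈ Set.Ioo (0:ℝ) 2) :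
    Tendsto (fun n => Fh N ξ (h n) α) atTop (𝓝 (∫⁻ x, ENNReal.ofReal (ker N ξ α x))) := by
  obtain ⟨C, hC0, hC⟩ := kernel_dom hN
  set M : ℝ := ((2 + ‖ξ‖ ^ 2) * (1 + (N:ℝ)) ^ 2 * (1 + (N:ℝ)) ^ ((N : ℝ) + 2)) with hM
  have hM0 : 0 ≤ M := by positivity
  simp_rw [fun n => Fh_eq (hh n) ξ α]
  refine tendsto_lintegral_of_dominated_convergence
    (fun x => ENNReal.ofReal M * ENNReal.ofReal (‖x‖ ^ (-((N : ℝ) + α)) * min 1 (‖x‖ ^ 2))) ?_ ?_ ?_ ?_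
  · intro n
    exact ((measurable_ker ξ α).comp measurable_gr).ennreal_ofReal
  · intro n
    refine Eventually.of_forall fun x => ?_
    simp only
    rw [← ENNReal.ofReal_mul hM0]
    exact ENNReal.ofReal_le_ofReal (ker_gr_le (hh n) ξ hα x)
  · rw [lintegral_const_mul' _ _ (by simp)]
    exact ENNReal.mul_ne_top (by simp) (ne_top_of_le_ne_top (by simp) (hC α hα))
  · have : Nonempty (Fin N) := ⟨⟨0, hN⟩⟩
    have hz : ∀ᵐ x : EuclideanSpace ℝ (Fin N), x ≠ 0 := by
      have : (volume : Measure (EuclideanSpace ℝ (Fin N))) {0} = 0 := measure_singleton 0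
      exact compl_mem_ae_iff.mpr this
    filter_upwards [hz] with x hx
    have hc : ContinuousAt (ker N ξ α) x := by
      unfold ker
      refine ContinuousAt.mul (by fun_prop) ?_
      exact ContinuousAt.rpow_const (by fun_prop) (Or.inl (norm_ne_zero_iff.mpr hx))
    exact (ENNReal.continuous_ofReal.continuousAt.comp hc).tendsto.comp (gr_tendsto hh h0 x)

lemma main_tendsto {N : ℕ} (hN : 1 ≤ N) (ξ : EuclideanSpace ℝ (Fin N)) {h : ℕ → ℝ} (hh : ∀ n, 0 < h n)
    (h0 : Tendsto h atTop (𝓝 0)) {a : ℝ → ℝ} (ha_meas : Measurable a) (ha_nonneg : ∀ s, 0 ≤ a s)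
    (ha_int : Integrable a) :
    Tendsto (fun n => ∫⁻ α in Set.Ioo (0:ℝ) 2, ENNReal.ofReal (a α * bConst N α) * Fh N ξ (h n) α)
      atTop (𝓝 (∫⁻ α in Set.Ioo (0:ℝ) 2, ENNReal.ofReal (a α * ‖ξ‖ ^ α / 2))) := by
  obtain ⟨C, hC0, hC⟩ := Fh_le hN ξ
  obtain ⟨B, hB0, hB⟩ := bConst_bound hN
  refine tendsto_lintegral_of_dominated_convergence'
    (fun α => ENNReal.ofReal (B * C) * ENNReal.ofReal (a α)) ?_ ?_ ?_ ?_
  · intro n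
    refine AEMeasurable.mul ?_ (measurable_Fh ξ).aemeasurable
    exact (ha_meas.aemeasurable.mul ((bConst_cont hN).aemeasurable measurableSet_Ioo)).ennreal_ofReal
  · intro n
    filter_upwards [ae_restrict_mem measurableSet_Ioo] with α hα
    have hd : 0 < α * (2 - α) := mul_pos hα.1 (by linarith [hα.2])
    have hb := bConst_pos (N := N) hα
    have ha := ha_nonneg α
    calc ENNReal.ofReal (a α * bConst N α) * Fh N ξ (h n) α
        ≤ ENNReal.ofReal (a α * bConst N α) * ENNReal.ofReal (C / (α * (2 - α))) := by
          gcongr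
          exact hC _ (hh n) α hα
      _ = ENNReal.ofReal (a α * bConst N α * (C / (α * (2 - α)))) := by
          rw [← ENNReal.ofReal_mul (by positivity)]
      _ ≤ ENNReal.ofReal (B * C * a α) := by
          apply ENNReal.ofReal_le_ofReal
          have h1 := hB α hα
          calc a α * bConst N α * (C / (α * (2 - α)))
              ≤ a α * (B * (α * (2 - α))) * (C / (α * (2 - α))) := by gcongr
            _ = B * C * a α := by
              have h1 : α ≠ 0 := hα.1.ne'
              have h2 : (2 - α) ≠ 0 := by have := hα.2; intro h; linarith
              field_simp
      _ = _ := by rw [ENNReal.ofReal_mul (by positivity)]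
  · rw [lintegral_const_mul' _ _ (by simp)]
    refine ENNReal.mul_ne_top (by simp) ?_
    exact ha_int.integrableOn.lintegral_lt_top.ne
  · filter_upwards [ae_restrict_mem measurableSet_Ioo] with α hα
    have ha := ha_nonneg α
    have e : ENNReal.ofReal (a α * ‖ξ‖ ^ α / 2) = ENNReal.ofReal (a α * bConst N α) *
        ∫⁻ x, ENNReal.ofReal (ker N ξ α x) := by
      rw [ENNReal.ofReal_mul ha, mul_assoc]
      unfold ker
      rw [kernel_exact hα.1 hα.2, ← ENNReal.ofReal_mul ha, mul_div_assoc]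
    rw [e]
    exact ENNReal.Tendsto.const_mul (Fh_tendsto hN ξ hh h0 hα) (Or.inr (by simp))


lemma latNorm_zero (N : ℕ) : latNorm N 0 = 0 := by simp [latNorm]

lemma latNorm_nonneg (N : ℕ) (m : Fin N → ℤ) : 0 ≤ latNorm N m := Real.sqrt_nonneg _

lemma latNorm_neg (N : ℕ) (m : Fin N → ℤ) : latNorm N (-m) = latNorm N m := by simp [latNorm]

lemma latEmbed_neg (N : ℕ) (m : Fin N → ℤ) : latEmbed N (-m) = - latEmbed N m := by
  ext i
  rw [PiLp.neg_apply, latEmbed_apply, latEmbed_apply]; simp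

lemma latEmbed_zero (N : ℕ) : latEmbed N 0 = 0 := by
  ext i
  rw [latEmbed_apply]; simp

lemma exp_ne {N : ℕ} {α : ℝ} (hα : α ∈ Set.Ioo (0:ℝ) 2) : -((N : ℝ) + α) ≠ 0 := by
  have : (0:ℝ) ≤ N := Nat.cast_nonneg N
  have := hα.1
  intro h; linarith

lemma lat_sum_ne_top {N : ℕ} (hN : 1 ≤ N) {α : ℝ} (hα : α ∈ Set.Ioo (0:ℝ) 2) :
    ∑' m : Fin N → ℤ, ENNReal.ofReal (latNorm N m ^ (-((N : ℝ) + α))) ≠ ∞ := by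
  obtain ⟨C, hC0, hC⟩ := kernel_dom hN
  have hr := riemann (N := N) one_pos (fun y => ENNReal.ofReal (‖y‖ ^ (-((N : ℝ) + α))))
  have e : ∑' m : Fin N → ℤ, ENNReal.ofReal (latNorm N m ^ (-((N : ℝ) + α))) =
      ∫⁻ x, ENNReal.ofReal (‖gr N 1 x‖ ^ (-((N : ℝ) + α))) := by
    rw [hr]; simp [norm_latEmbed]
  rw [e]
  have hb : ∀ x, ENNReal.ofReal (‖gr N 1 x‖ ^ (-((N : ℝ) + α))) ≤
      ENNReal.ofReal (4 * (1 + (N:ℝ)) ^ ((N : ℝ) + 2)) *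
        ENNReal.ofReal (‖x‖ ^ (-((N : ℝ) + α)) * min 1 (‖x‖ ^ 2)) := by
    intro x
    rw [← ENNReal.ofReal_mul (by positivity)]
    apply ENNReal.ofReal_le_ofReal
    by_cases hne : gr N 1 x = 0
    · rw [hne, norm_zero, Real.zero_rpow (exp_ne hα)]; positivity
    obtain ⟨h1, h2, h3⟩ := gr_compare one_pos x hne
    have hx : 0 < ‖x‖ := by linarith
    have hy : 0 < ‖gr N 1 x‖ := norm_pos_iff.mpr hne
    have h4 := rpow_compare hα hy hx h3
    have hm : 1 / 4 ≤ min 1 (‖x‖ ^ 2) := le_min (by norm_num) (by nlinarith)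
    calc _ ≤ _ := h4
      _ = (4 * (1 + (N:ℝ)) ^ ((N : ℝ) + 2)) * (‖x‖ ^ (-((N : ℝ) + α)) * (1/4)) := by ring
      _ ≤ _ := by gcongr
  refine ne_top_of_le_ne_top ?_ (lintegral_mono hb)
  rw [lintegral_const_mul' _ _ ENNReal.ofReal_ne_top]
  exact ENNReal.mul_ne_top ENNReal.ofReal_ne_top (ne_top_of_le_ne_top (by simp) (hC α hα))

lemma Rlat_eq {N : ℕ} (hN : 1 ≤ N) {α : ℝ} (hα : α ∈ Set.Ioo (0:ℝ) 2) :
    ENNReal.ofReal (Rlat N α) =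
      ∑' m : Fin N → ℤ, ENNReal.ofReal (latNorm N m ^ (-((N : ℝ) + α))) := by
  have hnn : ∀ m : Fin N → ℤ, 0 ≤ latNorm N m ^ (-((N : ℝ) + α)) :=
    fun m => Real.rpow_nonneg (latNorm_nonneg N m) _
  have hs : Summable (fun m : Fin N → ℤ => latNorm N m ^ (-((N : ℝ) + α))) := by
    have := ENNReal.summable_toReal (lat_sum_ne_top hN hα)
    refine this.congr fun m => ?_
    rw [ENNReal.toReal_ofReal (hnn m)]
  have e : Rlat N α = ∑' m : Fin N → ℤ, latNorm N m ^ (-((N : ℝ) + α)) := by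
    unfold Rlat
    refine tsum_subtype_eq_of_support_subset (s := {k : Fin N → ℤ | k ≠ 0})
      (f := fun m => latNorm N m ^ (-((N : ℝ) + α))) ?_
    intro m hm hm0
    apply hm
    simp only [hm0, latNorm_zero, Real.zero_rpow (exp_ne hα)]
  rw [e, ENNReal.ofReal_tsum_of_nonneg hnn hs]

/-- `Q_m / |m|^N` as an extended nonnegative integral -/
noncomputable def Gq (N : ℕ) (a : ℝ → ℝ) (h : ℝ) (m : Fin N → ℤ) : ℝ≥0∞ :=
  ∫⁻ α in Set.Ioo (0:ℝ) 2,
    ENNReal.ofReal (a α * bConst N α * h ^ (-α) * latNorm N m ^ (-((N : ℝ) + α)))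

lemma aemeas_int {N : ℕ} (hN : 1 ≤ N) {a : ℝ → ℝ} (ha_meas : Measurable a) (h : ℝ)
    (m : Fin N → ℤ) :
    AEMeasurable (fun α => a α * bConst N α * h ^ (-α) * latNorm N m ^ (-((N : ℝ) + α)))
      (volume.restrict (Set.Ioo (0:ℝ) 2)) := by
  have h1 := (bConst_cont hN).aemeasurable (μ := volume) measurableSet_Ioo
  have h2 : Measurable (fun α : ℝ => h ^ (-α)) := by fun_prop
  have h3 : Measurable (fun α : ℝ => latNorm N m ^ (-((N : ℝ) + α))) := by fun_prop
  exact ((ha_meas.aemeasurable.mul h1).mul h2.aemeasurable).mul h3.aemeasurable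

lemma q_eq {N : ℕ} (hN : 1 ≤ N) {a : ℝ → ℝ} (ha_meas : Measurable a) (ha_nonneg : ∀ s, 0 ≤ a s)
    {h : ℝ} (hh : 0 < h) (m : Fin N → ℤ) :
    Qcoef N a h m / latNorm N m ^ (N : ℝ) = (Gq N a h m).toReal := by
  unfold Qcoef Gq
  rw [intervalIntegral.integral_of_le (by norm_num), integral_Ioc_eq_integral_Ioo, ← integral_div,
    ← integral_eq_lintegral_of_nonneg_ae ?_ (aemeas_int hN ha_meas h m).aestronglyMeasurable]
  · refine setIntegral_congr_fun measurableSet_Ioo fun α hα => ?_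
    by_cases hm : latNorm N m = 0
    · have : (N:ℝ) ≠ 0 := by positivity
      rw [hm, Real.zero_rpow (exp_ne hα), Real.zero_rpow this]; simp
    · have hp : 0 < latNorm N m := lt_of_le_of_ne (latNorm_nonneg N m) (Ne.symm hm)
      rw [neg_add, Real.rpow_add hp, Real.rpow_neg hp.le (N:ℝ)]
      field_simp
  · filter_upwards [ae_restrict_mem measurableSet_Ioo] with α hα
    have := bConst_pos (N := N) hα
    have := ha_nonneg α
    have := latNorm_nonneg N m
    simp only [Pi.zero_apply]
    positivity

lemma Gq_zero {N : ℕ} {a : ℝ → ℝ} {h : ℝ} : Gq N a h 0 = 0 := by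
  unfold Gq
  rw [setLIntegral_congr_fun (g := fun _ => 0) measurableSet_Ioo]
  · simp
  · intro α hα
    simp only [latNorm_zero, Real.zero_rpow (exp_ne hα)]; simp

lemma Gq_neg {N : ℕ} {a : ℝ → ℝ} {h : ℝ} (m : Fin N → ℤ) : Gq N a h (-m) = Gq N a h m := by
  unfold Gq
  rw [latNorm_neg]

lemma Gq_sum {N : ℕ} (hN : 1 ≤ N) {a : ℝ → ℝ} (ha_meas : Measurable a) (ha_nonneg : ∀ s, 0 ≤ a s)
    {h : ℝ} (hh : 0 < h) :
    ∑' m, Gq N a h m = ∫⁻ α in Set.Ioo (0 : ℝ) 2,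
          ENNReal.ofReal (a α * bConst N α * Rlat N α * h ^ (-α)) := by
  unfold Gq
  rw [← lintegral_tsum fun m => (aemeas_int hN ha_meas h m).ennreal_ofReal]
  refine setLIntegral_congr_fun measurableSet_Ioo fun α hα => ?_
  have := bConst_pos (N := N) hα
  have := ha_nonneg α
  rw [mul_right_comm _ (Rlat N α), ENNReal.ofReal_mul (by positivity), Rlat_eq hN hα, ← ENNReal.tsum_mul_left]
  congr 1; ext m
  rw [← ENNReal.ofReal_mul (by positivity)]

lemma S_eq {N : ℕ} (hN : 1 ≤ N) {a : ℝ → ℝ} (ha_meas : Measurable a) (ha_nonneg : ∀ s, 0 ≤ a s)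
    {h : ℝ} (hh : 0 < h) (ξ : EuclideanSpace ℝ (Fin N)) :
    ∑' m, Gq N a h m * ENNReal.ofReal (1 - Real.cos ⟪h • latEmbed N m, ξ⟫) =
      ∫⁻ α in Set.Ioo (0 : ℝ) 2, ENNReal.ofReal (a α * bConst N α) * Fh N ξ h α := by
  unfold Gq
  have : ∀ m, (∫⁻ α in Set.Ioo (0:ℝ) 2,
    ENNReal.ofReal (a α * bConst N α * h ^ (-α) * latNorm N m ^ (-((N : ℝ) + α)))) *
      ENNReal.ofReal (1 - Real.cos ⟪h • latEmbed N m, ξ⟫) = ∫⁻ α in Set.Ioo (0:ℝ) 2,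
    ENNReal.ofReal (a α * bConst N α * h ^ (-α) * latNorm N m ^ (-((N : ℝ) + α))) *
      ENNReal.ofReal (1 - Real.cos ⟪h • latEmbed N m, ξ⟫) := fun m => by
    rw [lintegral_mul_const' _ _ (by simp)]
  simp_rw [this]
  rw [← lintegral_tsum fun m => (aemeas_int hN ha_meas h m).ennreal_ofReal.mul_const _]
  refine setLIntegral_congr_fun measurableSet_Ioo fun α hα => ?_
  have := bConst_pos (N := N) hα
  have := ha_nonneg α
  unfold Fh
  rw [← ENNReal.tsum_mul_left]
  congr 1; ext m
  have hL := latNorm_nonneg N m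
  have hp : 0 ≤ latNorm N m ^ (-((N : ℝ) + α)) := Real.rpow_nonneg hL _
  rw [← ENNReal.ofReal_mul (by positivity), ← ENNReal.ofReal_mul (by positivity),
    ← ENNReal.ofReal_mul (by positivity)]
  congr 1
  unfold ker
  rw [norm_smul, norm_latEmbed, Real.norm_of_nonneg hh.le, Real.mul_rpow hh.le hL,
    neg_add, Real.rpow_add hh, Real.rpow_neg hh.le (N:ℝ), Real.rpow_natCast]
  field_simp

section step
variable {N : ℕ} {a : ℝ → ℝ} {h τ : ℝ}

lemma trans_eq (hN : 1 ≤ N) (ha_meas : Measurable a) (ha_nonneg : ∀ s, 0 ≤ a s)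
    (hh : 0 < h) (k : Fin N → ℤ) :
    transProb N a τ h k = (if k = 0 then 1 - 2 * τ * ∑' m, (Gq N a h m).toReal else 0) +
      2 * τ * (Gq N a h k).toReal := by
  unfold transProb sigmaConst
  have e : ∑' m : {m : Fin N → ℤ // m ≠ 0}, Qcoef N a h m.1 / latNorm N m.1 ^ (N : ℝ) =
      ∑' m, (Gq N a h m).toReal := by
    simp_rw [q_eq hN ha_meas ha_nonneg hh]
    refine tsum_subtype_eq_of_support_subset (s := {k : Fin N → ℤ | k ≠ 0})
      (f := fun m => (Gq N a h m).toReal) ?_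
    intro m hm hm0
    apply hm
    simp only [hm0, Gq_zero]; simp
  rw [e, mul_div_assoc, q_eq hN ha_meas ha_nonneg hh]
  split_ifs with hk
  · rw [hk, Gq_zero]; simp
  · simp

lemma trans_sum (hN : 1 ≤ N) (ha_meas : Measurable a) (ha_nonneg : ∀ s, 0 ≤ a s)
    (hh : 0 < h) (hG : ∑' m, Gq N a h m ≠ ∞) :
    HasSum (transProb N a τ h) 1 := by
  have h1 := (ENNReal.summable_toReal hG).hasSum.mul_left (2 * τ)
  have h2 := hasSum_ite_eq (0 : Fin N → ℤ) (1 - 2 * τ * ∑' m, (Gq N a h m).toReal)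
  have h3 := h2.add h1
  rw [sub_add_cancel] at h3
  exact h3.congr_fun fun k => trans_eq hN ha_meas ha_nonneg hh k

lemma trans_nonneg (hN : 1 ≤ N) (ha_meas : Measurable a) (ha_nonneg : ∀ s, 0 ≤ a s)
    (hh : 0 < h) (hτ : 0 ≤ τ) (hG : ∑' m, Gq N a h m ≠ ∞)
    (hG1 : ENNReal.ofReal (2 * τ) * ∑' m, Gq N a h m ≤ 1) (k : Fin N → ℤ) :
    0 ≤ transProb N a τ h k := by
  rw [trans_eq hN ha_meas ha_nonneg hh]
  refine add_nonneg ?_ (by positivity)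
  split_ifs
  · rw [← ENNReal.tsum_toReal_eq (fun m => ENNReal.ne_top_of_tsum_ne_top hG m)]
    have := ENNReal.toReal_mono (by simp) hG1
    rw [ENNReal.toReal_mul, ENNReal.toReal_ofReal (by positivity)] at this
    simp at this
    linarith
  · exact le_rfl

lemma trans_neg (hN : 1 ≤ N) (ha_meas : Measurable a) (ha_nonneg : ∀ s, 0 ≤ a s)
    (hh : 0 < h) (k : Fin N → ℤ) : transProb N a τ h (-k) = transProb N a τ h k := by
  simp only [trans_eq hN ha_meas ha_nonneg hh, Gq_neg, neg_eq_zero]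

lemma jump_prob (hp : ∀ k, 0 ≤ transProb N a τ h k) (hs : HasSum (transProb N a τ h) 1) :
    IsProbabilityMeasure (jumpLaw N a τ h) := by
  constructor
  unfold jumpLaw
  rw [Measure.sum_apply _ MeasurableSet.univ]
  simp only [Measure.smul_apply, measure_univ, smul_eq_mul, mul_one]
  rw [← ENNReal.ofReal_tsum_of_nonneg hp hs.summable, hs.tsum_eq, ENNReal.ofReal_one]

lemma jump_char (hN : 1 ≤ N) (ha_meas : Measurable a) (ha_nonneg : ∀ s, 0 ≤ a s)
    (hh : 0 < h) (hG : ∑' m, Gq N a h m ≠ ∞) (hp : ∀ k, 0 ≤ transProb N a τ h k)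
    (ξ : EuclideanSpace ℝ (Fin N)) :
    charFun (jumpLaw N a τ h) ξ = ((1 + -(2 * τ * (∫⁻ α in Set.Ioo (0 : ℝ) 2,
      ENNReal.ofReal (a α * bConst N α) * Fh N ξ h α).toReal) : ℝ) : ℂ) := by
  have hs := trans_sum (τ := τ) hN ha_meas ha_nonneg hh hG
  set p := transProb N a τ h with hpdef
  set θ : (Fin N → ℤ) → ℝ := fun k => ⟪h • latEmbed N k, ξ⟫ with hθ
  have hθneg : ∀ k, θ (-k) = - θ k := fun k => by
    simp only [hθ, latEmbed_neg, smul_neg, inner_neg_left]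
  have h1 : HasSum (fun k => (p k : ℂ) * Complex.exp ((θ k : ℂ) * Complex.I))
      (charFun (jumpLaw N a τ h) ξ) := by
    rw [charFun_apply]
    have := hasSum_integral_sum_dirac (c := fun k => ENNReal.ofReal (p k))
      (x := fun k => h • latEmbed N k)
      (f := fun x : EuclideanSpace ℝ (Fin N) => Complex.exp (((⟪x, ξ⟫ : ℝ) : ℂ) * Complex.I))
      (by simp) (by
        simp only [Complex.norm_exp_ofReal_mul_I, mul_one]
        refine hs.summable.congr fun k => ?_
        rw [ENNReal.toReal_ofReal (hp k)])
    simp only [ENNReal.toReal_ofReal (hp _), Complex.real_smul] at this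
    exact this
  have h2 : HasSum (fun k => (p k : ℂ) * Complex.exp (-(θ k : ℂ) * Complex.I))
      (charFun (jumpLaw N a τ h) ξ) := by
    have := (Equiv.neg (Fin N → ℤ)).hasSum_iff.mpr h1
    refine this.congr_fun fun k => ?_
    simp only [Function.comp, Equiv.neg_apply, hθneg, hpdef,
      trans_neg hN ha_meas ha_nonneg hh, Complex.ofReal_neg]
  have h3 : HasSum (fun k => p k * (1 - Real.cos (θ k))) (2 * τ * (∫⁻ α in Set.Ioo (0 : ℝ) 2,
      ENNReal.ofReal (a α * bConst N α) * Fh N ξ h α).toReal) := by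
    rw [← S_eq hN ha_meas ha_nonneg hh]
    have hfin : ∑' m, Gq N a h m * ENNReal.ofReal (1 - Real.cos (θ m)) ≠ ∞ := by
      have hle : ∑' m, Gq N a h m * ENNReal.ofReal (1 - Real.cos (θ m)) ≤
          ∑' m, Gq N a h m * 2 := by
        refine ENNReal.tsum_le_tsum fun m => ?_
        gcongr
        refine ENNReal.ofReal_le_of_le_toReal ?_
        simp
        linarith [Real.neg_one_le_cos (θ m)]
      refine ne_top_of_le_ne_top ?_ hle
      rw [ENNReal.tsum_mul_right]
      exact ENNReal.mul_ne_top hG (by simp)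
    have h4 := (ENNReal.hasSum_toReal hfin).mul_left (2 * τ)
    rw [← ENNReal.tsum_toReal_eq (fun m => ENNReal.ne_top_of_tsum_ne_top hfin m)] at h4
    refine h4.congr_fun fun k => ?_
    rw [hpdef, trans_eq hN ha_meas ha_nonneg hh, ENNReal.toReal_mul, ENNReal.toReal_ofReal
      (by linarith [Real.cos_le_one (θ k)])]
    split_ifs with hk
    · simp [hk, hθ, latEmbed_zero]
    · ring
  have h5 : HasSum (fun k => p k * Real.cos (θ k)) (1 + -(2 * τ * (∫⁻ α in Set.Ioo (0 : ℝ) 2,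
      ENNReal.ofReal (a α * bConst N α) * Fh N ξ h α).toReal)) := by
    have := hs.sub h3
    rw [sub_eq_add_neg] at this
    refine this.congr_fun fun k => ?_
    ring
  have h6 := (h1.add h2).div_const 2
  have h7 := Complex.hasSum_ofReal.mpr h5
  rw [add_self_div_two] at h6
  refine h6.unique ?_
  refine h7.congr_fun fun k => ?_
  rw [Complex.ofReal_mul, Complex.ofReal_cos, Complex.cos]
  ring

end step

lemma convPow_prob {N : ℕ} (ν : Measure (EuclideanSpace ℝ (Fin N))) [IsProbabilityMeasure ν]
    (n : ℕ) : IsProbabilityMeasure (convPow ν n) := by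
  induction n with
  | zero => unfold convPow; infer_instance
  | succ n ih => unfold convPow; infer_instance

lemma convPow_char {N : ℕ} (ν : Measure (EuclideanSpace ℝ (Fin N))) [IsProbabilityMeasure ν]
    (n : ℕ) (ξ) : charFun (convPow ν n) ξ = charFun ν ξ ^ n := by
  induction n with
  | zero => simp [convPow]
  | succ n ih =>
    have := convPow_prob ν n
    rw [convPow, charFun_conv, ih, pow_succ]


lemma limit_eq {N : ℕ} {a : ℝ → ℝ} (ha_meas : Measurable a) (ha_nonneg : ∀ s, 0 ≤ a s)
    (ξ : EuclideanSpace ℝ (Fin N)) :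
    (∫⁻ α in Set.Ioo (0:ℝ) 2, ENNReal.ofReal (a α * ‖ξ‖ ^ α / 2)).toReal =
      (∫ α in (0 : ℝ)..2, a α * ‖ξ‖ ^ α) / 2 := by
  rw [intervalIntegral.integral_of_le (by norm_num), integral_Ioc_eq_integral_Ioo, ← integral_div,
    ← integral_eq_lintegral_of_nonneg_ae]
  · exact Eventually.of_forall fun α => by
      have := ha_nonneg α
      simp only [Pi.zero_apply]
      positivity
  · have : Measurable (fun α : ℝ => a α * ‖ξ‖ ^ α / 2) := by fun_prop
    exact this.aestronglyMeasurable

lemma limit_fin {N : ℕ} {a : ℝ → ℝ} (ha_nonneg : ∀ s, 0 ≤ a s) (ha_int : Integrable a)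
    (ξ : EuclideanSpace ℝ (Fin N)) :
    ∫⁻ α in Set.Ioo (0:ℝ) 2, ENNReal.ofReal (a α * ‖ξ‖ ^ α / 2) ≠ ∞ := by
  have hb : ∫⁻ α in Set.Ioo (0:ℝ) 2, ENNReal.ofReal (a α * ‖ξ‖ ^ α / 2) ≤
      ∫⁻ α in Set.Ioo (0:ℝ) 2, ENNReal.ofReal ((1 + ‖ξ‖) ^ (2:ℝ)) * ENNReal.ofReal (a α) := by
    refine setLIntegral_mono' measurableSet_Ioo fun α hα => ?_
    rw [← ENNReal.ofReal_mul (by positivity)]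
    apply ENNReal.ofReal_le_ofReal
    have ha := ha_nonneg α
    have h1 : ‖ξ‖ ^ α ≤ (1 + ‖ξ‖) ^ (2:ℝ) :=
      (Real.rpow_le_rpow (norm_nonneg ξ) (by linarith) hα.1.le).trans
        (Real.rpow_le_rpow_of_exponent_le (by linarith [norm_nonneg ξ]) hα.2.le)
    have h2 : 0 ≤ ‖ξ‖ ^ α := by positivity
    calc a α * ‖ξ‖ ^ α / 2 ≤ a α * ‖ξ‖ ^ α := by
          have := mul_nonneg ha h2
          linarith
      _ ≤ a α * (1 + ‖ξ‖) ^ (2:ℝ) := by gcongr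
      _ = _ := mul_comm _ _
  refine ne_top_of_le_ne_top ?_ hb
  rw [lintegral_const_mul' _ _ ENNReal.ofReal_ne_top]
  exact ENNReal.mul_ne_top ENNReal.ofReal_ne_top ha_int.integrableOn.lintegral_lt_top.ne

end Stmt12

/-- **Theorem 3.1 (convergence in law).** Under the scaling `τ_n = t/n`, `h_n → 0⁺` and the
normalization condition, the law `μ_n = ν_n^{*n}` of the walker's position at time `t`
converges weakly to the probability measure `μ` whose characteristic function is
`ξ ↦ exp(-t ∫₀² a(α)|ξ|^α dα)`. -/
theorem stmt_12 (N : ℕ) (hN : 1 ≤ N) (a : ℝ → ℝ)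
    (ha_meas : Measurable a) (ha_nonneg : ∀ s, 0 ≤ a s)
    (ha_supp : ∀ s, s ∉ Set.Ioo (0 : ℝ) 2 → a s = 0) (ha_int : Integrable a)
    (t : ℝ) (ht : 0 < t) (h : ℕ → ℝ) (hh_pos : ∀ n, 0 < h n)
    (hh0 : Tendsto h atTop (𝓝 0))
    (hcond : ∀ n : ℕ, ENNReal.ofReal (2 * (t / n)) *
        ∫⁻ α in Set.Ioo (0 : ℝ) 2,
          ENNReal.ofReal (a α * bConst N α * Rlat N α * h n ^ (-α)) ≤ 1)
    (μ : Measure (EuclideanSpace ℝ (Fin N))) [IsProbabilityMeasure μ]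
    (hμ : ∀ ξ : EuclideanSpace ℝ (Fin N),
      ∫ x, Complex.exp (Complex.I * ((⟪x, ξ⟫ : ℝ) : ℂ)) ∂μ
        = Complex.exp (-(((t * ∫ α in (0 : ℝ)..2, a α * ‖ξ‖ ^ α : ℝ)) : ℂ))) :
    ∀ f : BoundedContinuousFunction (EuclideanSpace ℝ (Fin N)) ℝ,
      Tendsto (fun n : ℕ => ∫ x, f x ∂(convPow (jumpLaw N a (t / n) (h n)) n))
        atTop (𝓝 (∫ x, f x ∂μ)) := by
  have hτ : ∀ n : ℕ, 0 ≤ t / n := fun n => by positivity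
  have hsum : ∀ n : ℕ, ENNReal.ofReal (2 * (t / n)) * ∑' m, Stmt12.Gq N a (h n) m ≤ 1 := fun n => by
    rw [Stmt12.Gq_sum hN ha_meas ha_nonneg (hh_pos n)]
    exact hcond n
  have hfin : ∀ n : ℕ, 1 ≤ n → ∑' m, Stmt12.Gq N a (h n) m ≠ ∞ := fun n hn htop => by
    have h1 := hsum n
    have h2 : (0:ℝ) < 2 * (t / n) := by
      have : (0:ℝ) < n := by exact_mod_cast hn
      positivity
    rw [htop, ENNReal.mul_top (by simpa using h2)] at h1
    simp at h1
  have hp : ∀ n : ℕ, 1 ≤ n → ∀ k, 0 ≤ transProb N a (t / n) (h n) k := fun n hn k =>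
    Stmt12.trans_nonneg hN ha_meas ha_nonneg (hh_pos n) (hτ n) (hfin n hn) (hsum n) k
  have hjp : ∀ n : ℕ, 1 ≤ n → IsProbabilityMeasure (jumpLaw N a (t / n) (h n)) := fun n hn =>
    Stmt12.jump_prob (hp n hn)
      (Stmt12.trans_sum hN ha_meas ha_nonneg (hh_pos n) (hfin n hn))
  have hcp : ∀ n : ℕ, IsProbabilityMeasure (convPow (jumpLaw N a (t / n) (h n)) n) := fun n => by
    rcases Nat.eq_zero_or_pos n with h0 | h0
    · subst h0
      rw [convPow]; infer_instance
    · have := hjp n h0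
      exact Stmt12.convPow_prob _ n
  let P : ℕ → ProbabilityMeasure (EuclideanSpace ℝ (Fin N)) := fun n => ⟨_, hcp n⟩
  let P0 : ProbabilityMeasure (EuclideanSpace ℝ (Fin N)) := ⟨μ, inferInstance⟩
  have hmain : Tendsto P atTop (𝓝 P0) := by
    refine ProbabilityMeasure.tendsto_of_tendsto_charFun fun ξ => ?_
    change Tendsto (fun n : ℕ => charFun (convPow (jumpLaw N a (t / n) (h n)) n) ξ) atTop
      (𝓝 (charFun μ ξ))
    have hlim : charFun μ ξ = ((Real.exp (-(t * ∫ α in (0 : ℝ)..2, a α * ‖ξ‖ ^ α)) : ℝ) : ℂ) := by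
      rw [charFun_apply, Complex.ofReal_exp, Complex.ofReal_neg, ← hμ ξ]
      simp_rw [mul_comm]
    rw [hlim]
    set S : ℕ → ℝ := fun n => (∫⁻ α in Set.Ioo (0 : ℝ) 2,
      ENNReal.ofReal (a α * bConst N α) * Stmt12.Fh N ξ (h n) α).toReal with hS
    have hST : Tendsto S atTop (𝓝 ((∫ α in (0 : ℝ)..2, a α * ‖ξ‖ ^ α) / 2)) := by
      rw [← Stmt12.limit_eq ha_meas ha_nonneg ξ]
      exact (ENNReal.tendsto_toReal (Stmt12.limit_fin ha_nonneg ha_int ξ)).comp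
        (Stmt12.main_tendsto hN ξ hh_pos hh0 ha_meas ha_nonneg ha_int)
    have hg : Tendsto (fun n : ℕ => (n : ℝ) * -(2 * (t / n) * S n)) atTop
        (𝓝 (-(t * ∫ α in (0 : ℝ)..2, a α * ‖ξ‖ ^ α))) := by
      have h1 := hST.const_mul (-(2 * t))
      rw [show -(2 * t) * ((∫ α in (0 : ℝ)..2, a α * ‖ξ‖ ^ α) / 2) =
        -(t * ∫ α in (0 : ℝ)..2, a α * ‖ξ‖ ^ α) by ring] at h1
      refine h1.congr' ?_
      filter_upwards [eventually_ge_atTop 1] with n hn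
      have : (n : ℝ) ≠ 0 := by positivity
      field_simp
    have hexp := Real.tendsto_one_add_pow_exp_of_tendsto hg
    refine ((Complex.continuous_ofReal.tendsto _).comp hexp).congr' ?_
    filter_upwards [eventually_ge_atTop 1] with n hn
    have := hjp n hn
    rw [Stmt12.convPow_char, Stmt12.jump_char hN ha_meas ha_nonneg (hh_pos n) (hfin n hn) (hp n hn) ξ]
    simp only [Function.comp, Complex.ofReal_pow, hS]
  exact ProbabilityMeasure.tendsto_iff_forall_integral_tendsto.mp hmain
end

section
/- (Theorem 3.2, characteristic-function form.) Let N ≥ 1, M ≥ 1 be integers, let 0 < α₁ < α₂ < ⋯ < α_M < 2 and a₁, …, a_M > 0, and fix t > 0. Let (h_n) be positive with h_n → 0, set τ_n = t/n and μ_m^{(n)} = 2τ_n/h_n^{α_m}, and assume for every n the condition Σ_{m=1}^M a_m b(α_m) R(α_m) μ_m^{(n)} ≤ 1. Define p₀^{(n)} = 1 − Σ_{j∈ℤ^N, j≠0} |j|^{−N} Σ_{m=1}^M μ_m^{(n)} a_m b(α_m) |j|^{−α_m} and, for k ≠ 0, p_k^{(n)} = |k|^{−N} Σ_{m=1}^M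 μ_m^{(n)} a_m b(α_m) |k|^{−α_m}. Then for every ξ ∈ ℝ^N, ( Σ_{k∈ℤ^N} p_k^{(n)} e^{i(h_n k)·ξ} )^n → exp( −t Σ_{m=1}^M a_m |ξ|^{α_m} ) as n → ∞. That is, the random walk converges in law to the process whose probability density is the fundamental solution of the multiterm fractional diffusion equation ∂u/∂t = Σ_{m=1}^M a_m D₀^{α_m} u. -/
open MeasureTheory Filter
open scoped Topology

/-- Euclidean inner product `k·ξ` of a lattice point `k ∈ ℤ^N` with `ξ ∈ ℝ^N`. -/
noncomputable def latDot (N : ℕ) (k : Fin N → ℤ) (ξ : EuclideanSpace ℝ (Fin N)) : ℝ :=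
  ∑ i, (k i : ℝ) * ξ i

/-- Transition probabilities of the multiterm random walk:
`p₀ = 1 - ∑_{j≠0} |j|^{-N} ∑_m μ_m a_m b(α_m) |j|^{-α_m}` and
`p_k = |k|^{-N} ∑_m μ_m a_m b(α_m) |k|^{-α_m}` for `k ≠ 0`, where `μ_m = 2τ/h^{α_m}`. -/
noncomputable def transProbMulti (N M : ℕ) (αv av : Fin M → ℝ) (τ h : ℝ)
    (k : Fin N → ℤ) : ℝ :=
  if k = 0 then
    1 - ∑' j : {j : Fin N → ℤ // j ≠ 0},
      (∑ m, (2 * τ / h ^ (αv m)) * av m * bConst N (αv m) * latNorm N j.1 ^ (-(αv m))) /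
        latNorm N j.1 ^ (N : ℝ)
  else
    (∑ m, (2 * τ / h ^ (αv m)) * av m * bConst N (αv m) * latNorm N k ^ (-(αv m))) /
      latNorm N k ^ (N : ℝ)

lemma aux_intA {p β : ℝ} (hβ : 0 < β) (hp : β < p) :
    IntegrableOn (fun r : ℝ => min 1 (r ^ p) * r ^ (-1 - β)) (Set.Ioi 0) := by
  have hu : Set.Ioi (0:ℝ) = Set.Ioc 0 1 ∪ Set.Ioi 1 := by
    rw [Set.Ioc_union_Ioi_eq_Ioi]; norm_num
  rw [hu]
  refine IntegrableOn.union ?_ ?_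
  · have h1 := intervalIntegral.intervalIntegrable_rpow' (a := 0) (b := 1) (r := p - 1 - β) (by linarith)
    rw [intervalIntegrable_iff_integrableOn_Ioc_of_le zero_le_one] at h1
    refine h1.congr_fun ?_ measurableSet_Ioc
    intro x hx
    have : x ^ p ≤ 1 := Real.rpow_le_one hx.1.le hx.2 (by linarith)
    simp only [min_eq_right this]
    rw [← Real.rpow_add hx.1]; congr 1; ring
  · have h1 := integrableOn_Ioi_rpow_of_lt (a := -1 - β) (c := 1) (by linarith) one_pos
    refine h1.congr_fun ?_ measurableSet_Ioi
    intro x hx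
    have : 1 ≤ x ^ p := Real.one_le_rpow (le_of_lt hx) (by linarith)
    simp only [min_eq_left this, one_mul]

lemma aux_intB {N : ℕ} (hN : 1 ≤ N) {α : ℝ} (h0 : 0 < α) (h2 : α < 2) :
    Integrable (fun y : Fin N → ℝ => min 1 (‖y‖ ^ (2:ℝ)) * ‖y‖ ^ (-((N:ℝ) + α))) := by
  have : Nonempty (Fin N) := ⟨⟨0, hN⟩⟩
  rw [integrable_fun_norm_addHaar volume (f := fun r : ℝ => min 1 (r ^ (2:ℝ)) * r ^ (-((N:ℝ) + α)))]
  refine (aux_intA h0 h2).congr_fun ?_ measurableSet_Ioi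
  intro x hx
  have hx : 0 < x := hx
  simp only [Module.finrank_fintype_fun_eq_card, Fintype.card_fin, smul_eq_mul]
  rw [mul_left_comm, ← Real.rpow_natCast, ← Real.rpow_add hx, Nat.cast_sub hN]
  congr 2; push_cast; ring

/-- `1 - e^{-cu} ≤ max 1 c * min 1 u`. -/
lemma aux_exp_bd {c u : ℝ} (hc : 0 < c) (hu : 0 < u) :
    0 ≤ 1 - Real.exp (-(c * u)) ∧ 1 - Real.exp (-(c * u)) ≤ (1 + c) * min 1 u := by
  have h1 : Real.exp (-(c * u)) ≤ 1 := Real.exp_le_one_iff.2 (by nlinarith)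
  have h2 := Real.add_one_le_exp (-(c * u))
  have h3 := Real.exp_pos (-(c * u))
  refine ⟨by linarith, ?_⟩
  rcases le_total 1 u with h | h
  · rw [min_eq_left h]; linarith
  · rw [min_eq_right h]; nlinarith

lemma aux_int_exp {β c : ℝ} (h0 : 0 < β) (h1 : β < 1) (hc : 0 < c) :
    IntegrableOn (fun u : ℝ => (1 - Real.exp (-(c * u))) * u ^ (-1 - β)) (Set.Ioi 0) ∧
    ∫ u in Set.Ioi (0:ℝ), (1 - Real.exp (-(c * u))) * u ^ (-1 - β)
      = c ^ β * Real.Gamma (1 - β) / β := by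
  have hI : IntegrableOn (fun u : ℝ => (1 - Real.exp (-(c * u))) * u ^ (-1 - β)) (Set.Ioi 0) := by
    refine Integrable.mono' ((aux_intA h0 h1).const_mul (1 + c)) ?_ ?_
    · exact (by fun_prop : Measurable fun u : ℝ => (1 - Real.exp (-(c * u))) * u ^ (-1 - β)).aestronglyMeasurable
    · filter_upwards [ae_restrict_mem measurableSet_Ioi] with u hu
      have hu : 0 < u := hu
      have := aux_exp_bd hc hu
      rw [Real.norm_of_nonneg (mul_nonneg this.1 (by positivity)), Real.rpow_one, ← mul_assoc]
      gcongr
      exact this.2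
  refine ⟨hI, ?_⟩
  have key := integral_Ioi_mul_deriv_eq_deriv_mul (a := 0) (a' := (0:ℝ)) (b' := 0)
    (u := fun u => 1 - Real.exp (-(c * u))) (v := fun u => u ^ (-β) / (-β))
    (u' := fun u => c * Real.exp (-(c * u))) (v' := fun u => u ^ (-1 - β)) ?_ ?_ hI ?_ ?_ ?_
  · rw [key]
    have := Real.integral_rpow_mul_exp_neg_mul_Ioi (a := 1 - β) (r := c) (by linarith) hc
    have e : (fun u : ℝ => c * Real.exp (-(c * u)) * (u ^ (-β) / (-β)))
      = fun u => (-(c / β)) * (u ^ (1 - β - 1) * Real.exp (-(c * u))) := by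
      ext u
      rw [show 1 - β - 1 = -β by ring]; field_simp
    rw [e, integral_const_mul, this, one_div, Real.inv_rpow hc.le, Real.rpow_sub hc, Real.rpow_one]
    have := Real.rpow_pos_of_pos hc β
    field_simp; ring
  · intro x hx
    have h5 : HasDerivAt (fun u : ℝ => -(c * u)) (-c) x := by
      have := (hasDerivAt_id x).const_mul (-c)
      simp only [id, mul_one, neg_mul] at this
      exact this
    have h6 := (h5.exp).const_sub 1
    exact h6.congr_deriv (by ring)
  · intro x hx
    have hx : 0 < x := hx
    have := (Real.hasDerivAt_rpow_const (x := x) (p := -β) (Or.inl hx.ne')).div_const (-β)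
    convert this using 1
    rw [show -β - 1 = -1 - β by ring]; field_simp
  · have := (integrableOn_rpow_mul_exp_neg_mul_rpow (p := 1) (s := -β) (b := c) (by linarith) one_pos hc).const_mul (-(c / β))
    refine this.congr (ae_of_all _ fun x => ?_)
    simp only [Real.rpow_one, Pi.mul_apply, neg_mul]
    field_simp
  · have hz : Tendsto (fun u : ℝ => c * u ^ (1 - β) / β) (𝓝[>] 0) (𝓝 0) := by
      have : Tendsto (fun u : ℝ => c * u ^ (1 - β) / β) (𝓝 0) (𝓝 (c * (0:ℝ) ^ (1 - β) / β)) := by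
        have := (Real.continuousAt_rpow_const (0:ℝ) (1 - β) (Or.inr (by linarith)))
        exact (this.tendsto.const_mul c).div_const β
      rw [Real.zero_rpow (by linarith)] at this
      simpa using this.mono_left nhdsWithin_le_nhds
    refine squeeze_zero_norm' ?_ hz
    filter_upwards [self_mem_nhdsWithin] with u hu
    have hu : 0 < u := hu
    have h3 := aux_exp_bd hc hu
    have h2 := Real.add_one_le_exp (-(c * u))
    simp only [Pi.mul_apply, norm_mul, norm_div, norm_neg, Real.norm_of_nonneg h3.1, Real.norm_of_nonneg h0.le]
    rw [Real.norm_of_nonneg (by positivity), mul_div_assoc']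
    rw [sub_eq_add_neg 1 β, Real.rpow_add hu, Real.rpow_one, ← mul_assoc]
    gcongr; linarith
  · have hz : Tendsto (fun u : ℝ => u ^ (-β) / β) atTop (𝓝 0) := by
      simpa using (tendsto_rpow_neg_atTop h0).div_const β
    refine squeeze_zero_norm' ?_ hz
    filter_upwards [eventually_gt_atTop 0] with u hu
    have h3 := aux_exp_bd hc hu
    simp only [Pi.mul_apply, norm_mul, norm_div, norm_neg, Real.norm_of_nonneg h3.1, Real.norm_of_nonneg h0.le]
    rw [Real.norm_of_nonneg (by positivity)]
    have := Real.exp_pos (-(c * u))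
    apply mul_le_of_le_one_left (by positivity); linarith

/-- the same integral after inversion `s = 1/u` -/
lemma aux_int_exp_inv {β c : ℝ} (h0 : 0 < β) (h1 : β < 1) (hc : 0 ≤ c) :
    ∫ s in Set.Ioi (0:ℝ), (1 - Real.exp (-(c / s))) * s ^ (β - 1)
      = c ^ β * Real.Gamma (1 - β) / β := by
  rcases hc.eq_or_lt with rfl | hc
  · simp [Real.zero_rpow h0.ne']
  rw [← (aux_int_exp h0 h1 hc).2, ← integral_comp_rpow_Ioi
    (fun u : ℝ => (1 - Real.exp (-(c * u))) * u ^ (-1 - β)) (p := -1) (by norm_num)]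
  refine setIntegral_congr_fun measurableSet_Ioi fun s hs => ?_
  have hs : 0 < s := hs
  simp only [smul_eq_mul, abs_neg, abs_one, one_mul, Real.rpow_neg_one, div_eq_mul_inv]
  rw [Real.inv_rpow hs.le, ← Real.rpow_neg hs.le, mul_left_comm, ← Real.rpow_add hs]
  congr 2; ring

/-- Euclidean norm on `Fin N → ℝ`. -/
noncomputable def aeN {N : ℕ} (y : Fin N → ℝ) : ℝ := Real.sqrt (∑ i, (y i) ^ 2)

noncomputable def aG {N : ℕ} (α : ℝ) (ξ : Fin N → ℝ) (y : Fin N → ℝ) : ℝ :=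
  (1 - Real.cos (∑ i, y i * ξ i)) * aeN y ^ (-((N:ℝ) + α))

noncomputable def aDom (N : ℕ) (α : ℝ) (y : Fin N → ℝ) : ℝ :=
  min 1 (‖y‖ ^ (2:ℝ)) * ‖y‖ ^ (-((N:ℝ) + α))

/-- rounding to the lattice `h ℤ^N` -/
noncomputable def aRd {N : ℕ} (h : ℝ) (y : Fin N → ℝ) : Fin N → ℤ := fun i => ⌊y i / h + 1 / 2⌋

noncomputable def aSc {N : ℕ} (h : ℝ) (k : Fin N → ℤ) : Fin N → ℝ := fun i => h * k i

lemma aDom_nonneg (N : ℕ) (α : ℝ) (y : Fin N → ℝ) : 0 ≤ aDom N α y := by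
  unfold aDom; positivity

lemma aeN_cont {N : ℕ} : Continuous (aeN (N := N)) := by unfold aeN; fun_prop

lemma norm_le_aeN {N : ℕ} (y : Fin N → ℝ) : ‖y‖ ≤ aeN y := by
  unfold aeN
  rw [pi_norm_le_iff_of_nonneg (Real.sqrt_nonneg _)]
  intro i
  rw [Real.norm_eq_abs]
  apply Real.abs_le_sqrt
  exact Finset.single_le_sum (f := fun i => y i ^ 2) (fun i _ => sq_nonneg _) (Finset.mem_univ i)

lemma aeN_pos {N : ℕ} {y : Fin N → ℝ} (hy : y ≠ 0) : 0 < aeN y :=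
  (norm_pos_iff.2 hy).trans_le (norm_le_aeN y)

lemma aeN_zero {N : ℕ} : aeN (0 : Fin N → ℝ) = 0 := by simp [aeN]

lemma aeN_rpow_le {N : ℕ} {α : ℝ} (h0 : 0 < α) (y : Fin N → ℝ) :
    aeN y ^ (-((N:ℝ) + α)) ≤ ‖y‖ ^ (-((N:ℝ) + α)) := by
  have hne : -((N:ℝ) + α) < 0 := by have : (0:ℝ) ≤ N := by positivity
                                    linarith
  rcases eq_or_ne y 0 with rfl | hy
  · rw [aeN_zero, norm_zero]
  · exact Real.rpow_le_rpow_of_nonpos (norm_pos_iff.2 hy) (norm_le_aeN y) hne.le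

lemma aG_nonneg {N : ℕ} (α : ℝ) (ξ y : Fin N → ℝ) : 0 ≤ aG α ξ y := by
  unfold aG aeN
  have := Real.cos_le_one (∑ i, y i * ξ i)
  exact mul_nonneg (by linarith) (by positivity)

lemma aG_le {N : ℕ} {α : ℝ} (h0 : 0 < α) (ξ y : Fin N → ℝ) :
    ‖aG α ξ y‖ ≤ (2 + (∑ i, |ξ i|) ^ 2) * aDom N α y := by
  rw [Real.norm_of_nonneg (aG_nonneg _ _ _)]
  unfold aG aDom
  rw [← mul_assoc]
  have hc := Real.cos_le_one (∑ i, y i * ξ i)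
  have hc' := Real.neg_one_le_cos (∑ i, y i * ξ i)
  refine mul_le_mul ?_ (aeN_rpow_le h0 y) (by unfold aeN; positivity) (by positivity)
  have hb : |∑ i, y i * ξ i| ≤ ‖y‖ * ∑ i, |ξ i| := by
    refine (Finset.abs_sum_le_sum_abs _ _).trans ?_
    rw [Finset.mul_sum]
    refine Finset.sum_le_sum fun i _ => ?_
    rw [abs_mul]
    gcongr
    exact norm_le_pi_norm y i
  have hb2 : (∑ i, y i * ξ i) ^ 2 ≤ ‖y‖ ^ 2 * (∑ i, |ξ i|) ^ 2 := by
    rw [← mul_pow, ← sq_abs]; gcongr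
  have h3 := Real.one_sub_sq_div_two_le_cos (x := ∑ i, y i * ξ i)
  have h4 := sq_nonneg (∑ i, |ξ i|)
  rw [Real.rpow_two]
  rcases le_total 1 (‖y‖ ^ 2) with h | h
  · rw [min_eq_left h]; linarith
  · rw [min_eq_right h]; nlinarith [sq_nonneg ‖y‖, mul_nonneg (sq_nonneg ‖y‖) h4]

lemma aRd_err {N : ℕ} {h : ℝ} (hh : 0 < h) (y : Fin N → ℝ) : ‖aSc h (aRd h y) - y‖ ≤ h / 2 := by
  rw [pi_norm_le_iff_of_nonneg (by positivity)]
  intro i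
  simp only [Pi.sub_apply, aSc, aRd, Real.norm_eq_abs]
  have h1 := Int.floor_le (y i / h + 1 / 2)
  have h2 := Int.lt_floor_add_one (y i / h + 1 / 2)
  have e : y i = h * (y i / h) := by field_simp
  set q := y i / h
  rw [e, ← mul_sub, abs_mul, abs_of_pos hh]
  have : |(⌊q + 1 / 2⌋ : ℝ) - q| ≤ 1 / 2 := by rw [abs_le]; constructor <;> linarith
  nlinarith

lemma aSc_norm {N : ℕ} {h : ℝ} (hh : 0 < h) {k : Fin N → ℤ} (hk : k ≠ 0) : h ≤ ‖aSc h k‖ := by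
  obtain ⟨i, hi⟩ := Function.ne_iff.1 hk
  refine le_trans ?_ (norm_le_pi_norm _ i)
  simp only [aSc, Real.norm_eq_abs, abs_mul, abs_of_pos hh]
  have : (1:ℝ) ≤ |(k i : ℝ)| := by exact_mod_cast Int.one_le_abs hi
  nlinarith

lemma aDom_zero {N : ℕ} {α : ℝ}  : aDom N α 0 = 0 := by
  simp [aDom]

lemma aDom_rd {N : ℕ} {α : ℝ} (h0 : 0 < α) {h : ℝ} (hh : 0 < h) (y : Fin N → ℝ) :
    aDom N α (aSc h (aRd h y)) ≤ 4 * (2:ℝ) ^ ((N:ℝ) + α) * aDom N α y := by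
  rcases eq_or_ne (aRd h y) 0 with hk | hk
  · have : aSc h (aRd h y) = 0 := by rw [hk]; ext i; simp [aSc]
    rw [this, aDom_zero]
    exact mul_nonneg (by positivity) (aDom_nonneg _ _ _)
  have e1 := aRd_err hh y
  have e2 := aSc_norm hh hk
  set z := aSc h (aRd h y)
  have e3 : ‖z‖ ≤ ‖y‖ + h / 2 := by
    calc ‖z‖ = ‖y + (z - y)‖ := by congr 1; abel
      _ ≤ _ := (norm_add_le _ _).trans (by gcongr)
  have e4 : ‖y‖ ≤ ‖z‖ + h / 2 := by
    calc ‖y‖ = ‖z - (z - y)‖ := by congr 1; abel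
      _ ≤ _ := (norm_sub_le _ _).trans (by gcongr)
  have f1 : ‖z‖ ≤ 2 * ‖y‖ := by linarith
  have f2 : ‖y‖ ≤ 2 * ‖z‖ := by linarith
  have hzp : 0 < ‖z‖ := by linarith
  have hyp : 0 < ‖y‖ := by linarith
  have hNn : (0:ℝ) ≤ N := by positivity
  unfold aDom
  rw [Real.rpow_two, Real.rpow_two, show 4 * (2:ℝ) ^ ((N:ℝ) + α) * (min 1 (‖y‖ ^ 2) * ‖y‖ ^ (-((N:ℝ) + α)))
    = (4 * min 1 (‖y‖ ^ 2)) * ((2:ℝ) ^ ((N:ℝ) + α) * ‖y‖ ^ (-((N:ℝ) + α))) by ring]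
  refine mul_le_mul ?_ ?_ (by positivity) (by positivity)
  · rcases le_total 1 (‖y‖ ^ 2) with h | h
    · rw [min_eq_left h]; exact (min_le_left _ _).trans (by norm_num)
    · rw [min_eq_right h]; exact (min_le_right _ _).trans (by nlinarith)
  · have : (2:ℝ) ^ ((N:ℝ) + α) * ‖y‖ ^ (-((N:ℝ) + α)) = (‖y‖ / 2) ^ (-((N:ℝ) + α)) := by
      rw [Real.div_rpow hyp.le (by norm_num), Real.rpow_neg (by norm_num : (0:ℝ) ≤ 2), div_inv_eq_mul, mul_comm]
    rw [this]
    exact Real.rpow_le_rpow_of_nonpos (by positivity) (by linarith) (by linarith)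

lemma aRd_meas {N : ℕ} (h : ℝ) : Measurable (aRd (N := N) h) := by
  unfold aRd
  refine measurable_pi_lambda _ fun i => ?_
  exact Int.measurable_floor.comp (by fun_prop)

lemma aCell_vol {N : ℕ} {h : ℝ} (hh : 0 < h) (k : Fin N → ℤ) :
    volume.real ((aRd (N := N) h) ⁻¹' {k}) = h ^ N := by
  have : (aRd (N := N) h) ⁻¹' {k} =
      Set.univ.pi fun i => Set.Ico (h * (k i - 1 / 2)) (h * (k i + 1 / 2)) := by
    ext y
    simp only [Set.mem_preimage, Set.mem_singleton_iff, Set.mem_pi, Set.mem_univ, true_imp_iff,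
      funext_iff, aRd, Int.floor_eq_iff, Set.mem_Ico]
    refine forall_congr' fun i => ?_
    have e : y i = h * (y i / h) := by field_simp
    set q := y i / h
    rw [e, mul_le_mul_iff_right₀ hh, mul_lt_mul_iff_right₀ hh]
    constructor <;> rintro ⟨h1, h2⟩ <;> constructor <;> linarith
  rw [this, Measure.real, Real.volume_pi_Ico]
  have : ∀ i, h * ((k i:ℝ) + 1 / 2) - h * ((k i : ℝ) - 1 / 2) = h := fun i => by ring
  simp only [this]
  simp [hh.le]

lemma aRiemann {N : ℕ} (hN : 1 ≤ N) {α : ℝ} (h0 : 0 < α) (h2 : α < 2) {h : ℝ} (hh : 0 < h)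
    (f : (Fin N → ℝ) → ℝ) (K : ℝ) (hK : 0 ≤ K) (hf : ∀ y, ‖f y‖ ≤ K * aDom N α y) :
    HasSum (fun k : Fin N → ℤ => h ^ N * f (aSc h k)) (∫ y, f (aSc h (aRd h y))) := by
  have hms : ∀ k, MeasurableSet ((aRd (N := N) h) ⁻¹' {k}) :=
    fun k => aRd_meas h (measurableSet_singleton k)
  have hU : (⋃ k, (aRd (N := N) h) ⁻¹' {k}) = Set.univ := by
    ext y; simp
  have hint : Integrable (fun y => f (aSc h (aRd h y))) := by
    refine Integrable.mono' ((aux_intB hN h0 h2).const_mul (K * (4 * (2:ℝ) ^ ((N:ℝ) + α)))) ?_ ?_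
    · have : Measurable fun k : Fin N → ℤ => f (aSc h k) := measurable_of_countable _
      exact (this.comp (aRd_meas h)).aestronglyMeasurable
    · refine ae_of_all _ fun y => (hf _).trans ?_
      rw [mul_assoc]
      gcongr
      exact aDom_rd h0 hh y
  have := hasSum_integral_iUnion (μ := volume) (f := fun y => f (aSc h (aRd h y))) hms ?_ hint.integrableOn
  · rw [hU, setIntegral_univ] at this
    have hfun : (fun k : Fin N → ℤ => h ^ N * f (aSc h k)) =
        fun k => ∫ y in (aRd (N := N) h) ⁻¹' {k}, f (aSc h (aRd h y)) := by
      funext k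
      rw [setIntegral_congr_fun (g := fun _ => f (aSc h k)) (hms k)]
      · rw [setIntegral_const, aCell_vol hh, smul_eq_mul]
      · intro y hy
        have hy : aRd h y = k := hy
        simp only [hy]
    rw [hfun]
    exact this
  · intro i j hij
    exact Disjoint.preimage _ (by simpa using hij)

lemma aG_tendsto {N : ℕ} (hN : 1 ≤ N) {α : ℝ} (h0 : 0 < α) (h2 : α < 2) (ξ : Fin N → ℝ)
    {h : ℕ → ℝ} (hh : ∀ n, 0 < h n) (hh0 : Tendsto h atTop (𝓝 0)) :
    Tendsto (fun n => ∫ y, aG α ξ (aSc (h n) (aRd (h n) y))) atTop (𝓝 (∫ y, aG α ξ y)) := by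
  have : Nonempty (Fin N) := ⟨⟨0, hN⟩⟩
  refine tendsto_integral_of_dominated_convergence
    (fun y => ((2 + (∑ i, |ξ i|) ^ 2) * (4 * (2:ℝ) ^ ((N:ℝ) + α))) * aDom N α y) ?_
    ((aux_intB hN h0 h2).const_mul _) ?_ ?_
  · intro n
    have : Measurable fun k : Fin N → ℤ => aG α ξ (aSc (h n) k) := measurable_of_countable _
    exact (this.comp (aRd_meas _)).aestronglyMeasurable
  · intro n
    refine ae_of_all _ fun y => (aG_le h0 _ _).trans ?_
    rw [mul_assoc]
    gcongr
    exact aDom_rd h0 (hh n) y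
  · have hne : ∀ᵐ y : Fin N → ℝ, y ≠ 0 := by
      simp [ae_iff]
    filter_upwards [hne] with y hy
    have hz : Tendsto (fun n => aSc (h n) (aRd (h n) y)) atTop (𝓝 y) := by
      rw [tendsto_iff_norm_sub_tendsto_zero]
      exact squeeze_zero (fun _ => norm_nonneg _) (fun n => aRd_err (hh n) y)
        (by simpa using hh0.div_const 2)
    have hc : ContinuousAt (aG α ξ) y := by
      unfold aG
      refine ContinuousAt.mul (Continuous.continuousAt (by fun_prop)) ?_
      exact aeN_cont.continuousAt.rpow_const (Or.inl (aeN_pos hy).ne')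
    exact hc.tendsto.comp hz

lemma aG_integrable {N : ℕ} (hN : 1 ≤ N) {α : ℝ} (h0 : 0 < α) (h2 : α < 2) (ξ : Fin N → ℝ) :
    Integrable (aG α ξ) := by
  refine Integrable.mono' ((aux_intB hN h0 h2).const_mul (2 + (∑ i, |ξ i|) ^ 2)) ?_
    (ae_of_all _ fun y => aG_le h0 ξ y)
  unfold aG
  have := (aeN_cont (N := N)).measurable
  exact (by fun_prop : Measurable fun y : Fin N → ℝ =>
    (1 - Real.cos (∑ i, y i * ξ i)) * aeN y ^ (-((N:ℝ) + α))).aestronglyMeasurable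

lemma aGauss {N : ℕ} {s : ℝ} (hs : 0 < s) (ξ : Fin N → ℝ) :
    Integrable (fun y : Fin N → ℝ => Real.cos (∑ i, y i * ξ i) * Real.exp (-(s * ∑ i, y i ^ 2))) ∧
    ∫ y : Fin N → ℝ, Real.cos (∑ i, y i * ξ i) * Real.exp (-(s * ∑ i, y i ^ 2))
      = (Real.pi / s) ^ ((N:ℝ) / 2) * Real.exp (-((∑ i, ξ i ^ 2) / 4 / s)) := by
  have hb : 0 < ((s : ℂ)).re := by simpa using hs
  have hI := GaussianFourier.integrable_cexp_neg_mul_sum_add hb (fun i => Complex.I * (ξ i : ℂ))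
  have hV := GaussianFourier.integral_cexp_neg_mul_sum_add hb (fun i => Complex.I * (ξ i : ℂ))
  have e : ∀ y : Fin N → ℝ, Real.cos (∑ i, y i * ξ i) * Real.exp (-(s * ∑ i, y i ^ 2)) =
      RCLike.re (Complex.exp (-(s:ℂ) * ∑ i, (y i : ℂ) ^ 2 + ∑ i, Complex.I * (ξ i : ℂ) * (y i : ℂ))) := by
    intro y
    have : -(s:ℂ) * ∑ i, (y i : ℂ) ^ 2 + ∑ i, Complex.I * (ξ i : ℂ) * (y i : ℂ)
      = ((-(s * ∑ i, y i ^ 2) : ℝ) : ℂ) + ((∑ i, y i * ξ i : ℝ) : ℂ) * Complex.I := by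
      push_cast
      rw [Finset.sum_mul]
      congr 1
      · ring
      · exact Finset.sum_congr rfl fun i _ => by ring
    rw [this]
    simp only [RCLike.re_eq_complex_re, Complex.exp_re]
    simp only [Complex.add_re, Complex.add_im, Complex.ofReal_re, Complex.ofReal_im,
      Complex.re_ofReal_mul, Complex.im_ofReal_mul, Complex.I_re, Complex.I_im]
    simp only [mul_zero, add_zero, mul_one, zero_add]
    ring
  refine ⟨?_, ?_⟩
  · simp_rw [e]; exact hI.re
  · simp_rw [e]
    rw [integral_re hI, hV]
    have e2 : ((Real.pi : ℂ) / s) ^ ((Fintype.card (Fin N) : ℂ) / 2) *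
        Complex.exp ((∑ i, (Complex.I * (ξ i : ℂ)) ^ 2) / (4 * s)) =
        (((Real.pi / s) ^ ((N:ℝ) / 2) * Real.exp (-((∑ i, ξ i ^ 2) / 4 / s)) : ℝ) : ℂ) := by
      push_cast
      rw [Complex.ofReal_cpow (by positivity)]
      push_cast
      simp only [Fintype.card_fin, mul_pow, Complex.I_sq]
      congr 2
      rw [← Finset.mul_sum]
      field_simp
    rw [e2]
    exact Complex.ofReal_re _

lemma aG_integral {N : ℕ} (hN : 1 ≤ N) {α : ℝ} (h0 : 0 < α) (h2 : α < 2) (ξ : Fin N → ℝ) :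
    2 * bConst N α * ∫ y, aG α ξ y = aeN ξ ^ α := by
  have hNe : Nonempty (Fin N) := ⟨⟨0, hN⟩⟩
  have hNp : (0:ℝ) < N := by exact_mod_cast hN
  set γ : ℝ := ((N:ℝ) + α) / 2 with hγ
  have hγp : 0 < γ := by positivity
  have hne : ∀ᵐ y : Fin N → ℝ, y ≠ 0 := by simp [ae_iff]
  let F : (Fin N → ℝ) → ℝ → ℝ := fun y s =>
    (1 - Real.cos (∑ i, y i * ξ i)) * (s ^ (γ - 1) * Real.exp (-((∑ i, y i ^ 2) * s)))
  have hsq : ∀ y : Fin N → ℝ, ∑ i, y i ^ 2 = aeN y ^ 2 := fun y =>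
    (Real.sq_sqrt (Finset.sum_nonneg fun i _ => sq_nonneg _)).symm
  have hF1 : ∀ y : Fin N → ℝ, y ≠ 0 → ∫ s in Set.Ioi (0:ℝ), F y s = Real.Gamma γ * aG α ξ y := by
    intro y hy
    have hp := aeN_pos hy
    have h1 : 0 < ∑ i, y i ^ 2 := by rw [hsq]; positivity
    simp only [F]
    rw [integral_const_mul, Real.integral_rpow_mul_exp_neg_mul_Ioi hγp h1, hsq, one_div,
      Real.inv_rpow (by positivity), ← Real.rpow_neg (by positivity), ← Real.rpow_natCast,
      ← Real.rpow_mul hp.le]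
    unfold aG
    rw [show ((2:ℕ):ℝ) * -γ = -((N:ℝ) + α) by rw [hγ]; push_cast; ring]
    ring
  have hFpos : ∀ y, ∀ s ∈ Set.Ioi (0:ℝ), 0 ≤ F y s := by
    intro y s hs
    have hs : 0 < s := hs
    have := Real.cos_le_one (∑ i, y i * ξ i)
    exact mul_nonneg (by linarith) (by positivity)
  have hFm : Measurable (Function.uncurry F) := by
    simp only [F, Function.uncurry_def]
    fun_prop
  have hFint : Integrable (Function.uncurry F) (volume.prod (volume.restrict (Set.Ioi (0:ℝ)))) := by
    rw [integrable_prod_iff hFm.aestronglyMeasurable]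
    constructor
    · filter_upwards [hne] with y hy
      have hp := aeN_pos hy
      have h1 : 0 < ∑ i, y i ^ 2 := by rw [hsq]; positivity
      have := (integrableOn_rpow_mul_exp_neg_mul_rpow (p := 1) (s := γ - 1) (b := ∑ i, y i ^ 2)
        (by linarith) one_pos h1).const_mul (1 - Real.cos (∑ i, y i * ξ i))
      refine this.congr (ae_of_all _ fun x => ?_)
      simp only [Real.rpow_one, Function.uncurry, F, neg_mul]
    · refine ((aG_integrable hN h0 h2 ξ).const_mul (Real.Gamma γ)).congr ?_
      filter_upwards [hne] with y hy
      rw [← hF1 y hy]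
      refine setIntegral_congr_fun measurableSet_Ioi fun s hs => ?_
      simp only [Function.uncurry]
      rw [Real.norm_of_nonneg (hFpos y s hs)]
  have hswap := integral_integral_swap hFint
  have hL : ∫ y, ∫ s in Set.Ioi (0:ℝ), F y s = Real.Gamma γ * ∫ y, aG α ξ y := by
    rw [← integral_const_mul]
    refine integral_congr_ae ?_
    filter_upwards [hne] with y hy using hF1 y hy
  have hR : ∀ s ∈ Set.Ioi (0:ℝ), ∫ y, F y s =
      Real.pi ^ ((N:ℝ) / 2) * ((1 - Real.exp (-((∑ i, ξ i ^ 2) / 4 / s))) * s ^ (α / 2 - 1)) := by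
    intro s hs
    have hs : 0 < s := hs
    have g0 := aGauss hs (0 : Fin N → ℝ)
    have g1 := aGauss hs ξ
    simp only [Pi.zero_apply, mul_zero, Finset.sum_const_zero, Real.cos_zero, one_mul] at g0
    have : ∀ y, F y s = s ^ (γ - 1) * (Real.exp (-(s * ∑ i, y i ^ 2)) -
      Real.cos (∑ i, y i * ξ i) * Real.exp (-(s * ∑ i, y i ^ 2))) := by
      intro y
      simp only [F]
      rw [mul_comm (∑ i, y i ^ 2) s]; ring
    simp_rw [this]
    rw [integral_const_mul, integral_sub g0.1 g1.1, g0.2, g1.2, Real.div_rpow Real.pi_pos.le hs.le]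
    have e : s ^ (γ - 1) = s ^ ((N:ℝ) / 2) * s ^ (α / 2 - 1) := by
      rw [← Real.rpow_add hs]; congr 1; rw [hγ]; ring
    rw [e]
    have := Real.rpow_pos_of_pos hs ((N:ℝ) / 2)
    field_simp
    simp
  have hξ : 0 ≤ aeN ξ := Real.sqrt_nonneg _
  rw [hL, setIntegral_congr_fun measurableSet_Ioi hR, integral_const_mul,
    aux_int_exp_inv (by positivity) (by linarith) (by rw [hsq]; positivity)] at hswap
  have hGp := Real.Gamma_pos_of_pos hγp
  have hrefl := Real.Gamma_mul_Gamma_one_sub (α / 2)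
  have hsin : 0 < Real.sin (Real.pi * (α / 2)) :=
    Real.sin_pos_of_pos_of_lt_pi (by positivity) (by nlinarith [Real.pi_pos])
  rw [eq_div_iff hsin.ne'] at hrefl
  have hc : ((∑ i, ξ i ^ 2) / 4) ^ (α / 2) = aeN ξ ^ α / 2 ^ α := by
    rw [hsq, show aeN ξ ^ 2 / 4 = (aeN ξ / 2) ^ (2:ℝ) by rw [Real.rpow_two]; ring,
      ← Real.rpow_mul (by positivity), Real.div_rpow hξ (by norm_num)]
    congr 2 <;> ring
  rw [hc] at hswap
  have hA : ∫ y, aG α ξ y = Real.pi ^ ((N:ℝ) / 2) *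
    (aeN ξ ^ α / 2 ^ α * Real.Gamma (1 - α / 2) / (α / 2)) / Real.Gamma γ := by
    rw [eq_div_iff hGp.ne', ← hswap]; ring
  rw [hA, bConst, ← hγ, show α * Real.pi / 2 = Real.pi * (α / 2) by ring,
    Real.rpow_add Real.pi_pos, Real.rpow_one, Real.rpow_sub two_pos]
  have p1 := Real.pi_pos
  have p2 := Real.rpow_pos_of_pos p1 ((N:ℝ) / 2)
  have p3 := Real.rpow_pos_of_pos two_pos α
  have : Real.Gamma (α / 2) * Real.sin (Real.pi * (α / 2)) * Real.Gamma (1 - α / 2) = Real.pi := by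
    linear_combination hrefl
  calc _ = (Real.Gamma (α / 2) * Real.sin (Real.pi * (α / 2)) * Real.Gamma (1 - α / 2)) / Real.pi * aeN ξ ^ α := by
        rw [show (2:ℝ) ^ (2:ℝ) = 4 by norm_num]
        field_simp
        ring
    _ = _ := by rw [this]; field_simp

lemma aSc_aeN {N : ℕ} {h : ℝ} (hh : 0 < h) (k : Fin N → ℤ) : aeN (aSc h k) = h * latNorm N k := by
  unfold aeN aSc latNorm
  simp only [mul_pow]
  rw [← Finset.mul_sum, Real.sqrt_mul (by positivity), Real.sqrt_sq hh.le]

lemma latNorm_pos {N : ℕ} {k : Fin N → ℤ} (hk : k ≠ 0) : 0 < latNorm N k := by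
  have h1 := aSc_norm one_pos hk
  have h2 := norm_le_aeN (aSc 1 k)
  rw [aSc_aeN one_pos] at h2
  linarith

lemma latNorm_rpow_zero {N : ℕ} {α : ℝ} (h0 : 0 < α) :
    latNorm N (0 : Fin N → ℤ) ^ (-((N:ℝ) + α)) = 0 := by
  have : (0:ℝ) ≤ N := by positivity
  have h1 : latNorm N (0 : Fin N → ℤ) = 0 := by simp [latNorm]
  rw [h1, Real.zero_rpow (by linarith)]

lemma aSummable {N : ℕ} (hN : 1 ≤ N) {α : ℝ} (h0 : 0 < α) (h2 : α < 2) :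
    Summable (fun k : Fin N → ℤ => latNorm N k ^ (-((N:ℝ) + α))) := by
  have := (aRiemann hN h0 h2 one_pos
    (fun z => min 1 (‖z‖ ^ (2:ℝ)) * aeN z ^ (-((N:ℝ) + α))) 1 zero_le_one ?_).summable
  · refine this.congr fun k => ?_
    rw [aSc_aeN one_pos, one_pow, one_mul, one_mul]
    rcases eq_or_ne k 0 with rfl | hk
    · rw [latNorm_rpow_zero h0, mul_zero]
    · rw [min_eq_left, one_mul]
      exact Real.one_le_rpow (aSc_norm one_pos hk) (by norm_num)
  · intro y
    have hp : 0 ≤ aeN y := Real.sqrt_nonneg _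
    rw [Real.norm_of_nonneg (by positivity), one_mul]
    unfold aDom
    exact mul_le_mul_of_nonneg_left (aeN_rpow_le h0 y) (by positivity)

lemma aHasSum {N : ℕ} (hN : 1 ≤ N) {α : ℝ} (h0 : 0 < α) (h2 : α < 2) {h : ℝ} (hh : 0 < h)
    (ξ : EuclideanSpace ℝ (Fin N)) :
    HasSum (fun k : Fin N → ℤ => latNorm N k ^ (-((N:ℝ) + α)) * (1 - Real.cos (h * latDot N k ξ)))
      (h ^ α * ∫ y, aG α (fun i => ξ i) (aSc h (aRd h y))) := by
  have := (aRiemann hN h0 h2 hh (aG α (fun i => ξ i)) _ (by positivity) (aG_le h0 _)).mul_left (h ^ α)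
  have hfun : (fun k : Fin N → ℤ => latNorm N k ^ (-((N:ℝ) + α)) * (1 - Real.cos (h * latDot N k ξ)))
      = fun k => h ^ α * (h ^ N * aG α (fun i => ξ i) (aSc h k)) := by
    funext k
    have hl : 0 ≤ latNorm N k := Real.sqrt_nonneg _
    have e1 : ∑ i, aSc h k i * ξ i = h * latDot N k ξ := by
      simp only [aSc, latDot, Finset.mul_sum, mul_assoc]
    unfold aG
    rw [aSc_aeN hh, e1, Real.mul_rpow hh.le hl, Real.rpow_neg hh.le, Real.rpow_add hh, Real.rpow_natCast]
    have := Real.rpow_pos_of_pos hh α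
    field_simp
  rw [hfun]
  exact this

lemma aOdd {N : ℕ} {f : (Fin N → ℤ) → ℝ} (hf : Summable f) (ho : ∀ k, f (-k) = - f k) :
    HasSum f 0 := by
  have h1 := hf.hasSum
  have h2 := (Equiv.neg (Fin N → ℤ)).hasSum_iff.2 h1
  have h3 : (f ∘ (Equiv.neg (Fin N → ℤ))) = fun k => - f k := by
    funext k; simp [ho]
  rw [h3] at h2
  have h4 := h2.unique h1.neg
  have : ∑' k, f k = 0 := by linarith
  rwa [this] at h1

lemma aChar {N : ℕ} {q θ : (Fin N → ℤ) → ℝ} {S : ℝ} (hq : Summable q) (hq0 : q 0 = 0)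
    (hqn : ∀ k, q (-k) = q k) (hθn : ∀ k, θ (-k) = - θ k)
    (hS : HasSum (fun k => q k * (1 - Real.cos (θ k))) S)
    (p : (Fin N → ℤ) → ℝ) (hp0 : p 0 = 1 - ∑' k, q k) (hpk : ∀ k, k ≠ 0 → p k = q k) :
    ∑' k, (p k : ℂ) * Complex.exp (Complex.I * (θ k : ℂ)) = ((1 - S : ℝ) : ℂ) := by
  have hθ0 : θ 0 = 0 := by have := hθn 0; rw [neg_zero] at this; linarith
  have hsin : Summable fun k => q k * Real.sin (θ k) := by
    refine Summable.of_norm_bounded hq.abs fun k => ?_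
    rw [norm_mul, Real.norm_eq_abs, Real.norm_eq_abs]
    exact mul_le_of_le_one_right (abs_nonneg _) (Real.abs_sin_le_one _)
  have h1 := aOdd hsin (fun k => by simp [hqn, hθn])
  have h2 : HasSum (fun k : Fin N → ℤ => if k = 0 then (1 - ∑' k, q k) else 0) (1 - ∑' k, q k) :=
    hasSum_ite_eq 0 _
  have h3 : HasSum (fun k : Fin N → ℤ => (if k = 0 then (1 - ∑' k, q k) else 0) + q k -
      q k * (1 - Real.cos (θ k))) (1 - S) := by
    have := (h2.add hq.hasSum).sub hS
    rwa [show 1 - ∑' k, q k + ∑' k, q k - S = 1 - S by ring] at this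
  have h4 := (Complex.hasSum_ofReal.2 h3).add ((Complex.hasSum_ofReal.2 h1).mul_right Complex.I)
  rw [Complex.ofReal_zero, zero_mul, add_zero] at h4
  rw [← h4.tsum_eq]
  refine tsum_congr fun k => ?_
  rw [mul_comm Complex.I, Complex.exp_mul_I, ← Complex.ofReal_cos, ← Complex.ofReal_sin]
  rcases eq_or_ne k 0 with rfl | hk
  · simp [hp0, hθ0, hq0]
  · rw [hpk k hk, if_neg hk]
    push_cast
    ring

/-- **Theorem 3.2 (characteristic-function form).** For `0 < α₁ < ⋯ < α_M < 2`, positive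
`a₁, …, a_M`, scaling `τ_n = t/n`, `μ_m^{(n)} = 2τ_n/h_n^{α_m}` with `h_n → 0⁺` and the
condition `∑_m a_m b(α_m) R(α_m) μ_m^{(n)} ≤ 1`, the characteristic function of the `n`-step
random walk converges to `exp(-t ∑_m a_m |ξ|^{α_m})`, the Fourier transform of the fundamental
solution of the multiterm fractional diffusion equation. -/
theorem stmt_13 (N : ℕ) (hN : 1 ≤ N) (M : ℕ) (hM : 1 ≤ M)
    (αv : Fin M → ℝ) (hαv : ∀ m, αv m ∈ Set.Ioo (0 : ℝ) 2) (hmono : StrictMono αv)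
    (av : Fin M → ℝ) (hav : ∀ m, 0 < av m)
    (t : ℝ) (ht : 0 < t) (h : ℕ → ℝ) (hh_pos : ∀ n, 0 < h n)
    (hh0 : Tendsto h atTop (𝓝 0))
    (hcond : ∀ n : ℕ,
      ∑ m, av m * bConst N (αv m) * Rlat N (αv m) * (2 * (t / n) / h n ^ (αv m)) ≤ 1)
    (ξ : EuclideanSpace ℝ (Fin N)) :
    Tendsto (fun n : ℕ =>
        (∑' k : Fin N → ℤ,
            ((transProbMulti N M αv av (t / n) (h n) k : ℝ) : ℂ) *
              Complex.exp (Complex.I * ((h n * latDot N k ξ : ℝ) : ℂ))) ^ n)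
      atTop
      (𝓝 (Complex.exp (-(((t * ∑ m, av m * ‖ξ‖ ^ (αv m) : ℝ)) : ℂ)))) := by
  have hb : ∀ m, 2 * bConst N (αv m) * ∫ y, aG (αv m) (fun i => ξ i) y = ‖ξ‖ ^ αv m := by
    intro m
    rw [aG_integral hN (hαv m).1 (hαv m).2, EuclideanSpace.norm_eq]
    simp [aeN]
  have hneg : ∀ k : Fin N → ℤ, latNorm N (-k) = latNorm N k := fun k => by simp [latNorm]
  have hdneg : ∀ k : Fin N → ℤ, latDot N (-k) ξ = - latDot N k ξ := fun k => by simp [latDot]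
  let I : ℕ → Fin M → ℝ := fun n m => ∫ y, aG (αv m) (fun i => ξ i) (aSc (h n) (aRd (h n) y))
  have hI : ∀ m, Tendsto (fun n => I n m) atTop (𝓝 (∫ y, aG (αv m) (fun i => ξ i) y)) := fun m =>
    aG_tendsto hN (hαv m).1 (hαv m).2 _ hh_pos hh0
  have hchar : ∀ n : ℕ, ∑' k : Fin N → ℤ,
      ((transProbMulti N M αv av (t / n) (h n) k : ℝ) : ℂ) *
        Complex.exp (Complex.I * ((h n * latDot N k ξ : ℝ) : ℂ)) =
      ((1 - (t / n) * ∑ m, av m * (2 * bConst N (αv m) * I n m) : ℝ) : ℂ) := by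
    intro n
    let c : Fin M → ℝ := fun m => (2 * (t / n) / h n ^ (αv m)) * av m * bConst N (αv m)
    let q : (Fin N → ℤ) → ℝ := fun k => ∑ m, c m * latNorm N k ^ (-((N:ℝ) + αv m))
    have hq : Summable q := summable_sum fun m _ => (aSummable hN (hαv m).1 (hαv m).2).mul_left (c m)
    have hq0 : q 0 = 0 := Finset.sum_eq_zero fun m _ => by
      rw [latNorm_rpow_zero (hαv m).1, mul_zero]
    have hqk : ∀ k : Fin N → ℤ, k ≠ 0 →
        (∑ m, (2 * (t / n) / h n ^ (αv m)) * av m * bConst N (αv m) * latNorm N k ^ (-(αv m))) /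
        latNorm N k ^ (N : ℝ) = q k := by
      intro k hk
      rw [Finset.sum_div]
      refine Finset.sum_congr rfl fun m _ => ?_
      rw [mul_div_assoc, ← Real.rpow_sub (latNorm_pos hk)]
      congr 2
      ring
    have hS : HasSum (fun k => q k * (1 - Real.cos (h n * latDot N k ξ)))
        ((t / n) * ∑ m, av m * (2 * bConst N (αv m) * I n m)) := by
      have := hasSum_sum (s := Finset.univ) fun m (_ : m ∈ Finset.univ) =>
        (aHasSum hN (hαv m).1 (hαv m).2 (hh_pos n) ξ).mul_left (c m)
      have e1 : (fun k => q k * (1 - Real.cos (h n * latDot N k ξ))) = fun k => ∑ m, c m *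
          (latNorm N k ^ (-((N:ℝ) + αv m)) * (1 - Real.cos (h n * latDot N k ξ))) := by
        funext k
        simp only [q, Finset.sum_mul, mul_assoc]
      have e2 : (t / n) * ∑ m, av m * (2 * bConst N (αv m) * I n m) =
          ∑ m, c m * (h n ^ αv m * I n m) := by
        rw [Finset.mul_sum]
        refine Finset.sum_congr rfl fun m _ => ?_
        have := Real.rpow_pos_of_pos (hh_pos n) (αv m)
        simp only [c]
        field_simp
      rw [e1, e2]
      exact this
    refine aChar (q := q) (θ := fun k => h n * latDot N k ξ) hq hq0
      (fun k => by simp only [q, hneg]) (fun k => by simp only [hdneg, mul_neg]) hS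
      (transProbMulti N M αv av (t / n) (h n)) ?_ ?_
    · rw [transProbMulti, if_pos rfl]
      congr 1
      rw [← tsum_subtype_eq_of_support_subset (f := q) (s := {j | j ≠ 0})]
      · exact tsum_congr fun j => hqk j.1 j.2
      · intro k hk hk0
        exact hk (by rw [hk0, hq0])
    · intro k hk
      rw [transProbMulti, if_neg hk, hqk k hk]
  simp_rw [hchar]
  have hsum : Tendsto (fun n : ℕ => -(t * ∑ m, av m * (2 * bConst N (αv m) * I n m))) atTop
      (𝓝 (-(t * ∑ m, av m * ‖ξ‖ ^ (αv m)))) := by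
    refine (Tendsto.const_mul t (tendsto_finsetSum _ fun m _ => ?_)).neg
    rw [← hb m]
    exact ((hI m).const_mul _).const_mul _
  have hlim := Real.tendsto_one_add_pow_exp_of_tendsto
    (g := fun n : ℕ => -((t / n) * ∑ m, av m * (2 * bConst N (αv m) * I n m)))
    (t := -(t * ∑ m, av m * ‖ξ‖ ^ (αv m))) ?_
  · have := (Complex.continuous_ofReal.tendsto _).comp hlim
    rw [← Complex.ofReal_neg, ← Complex.ofReal_exp]
    refine this.congr fun n => ?_
    simp only [Function.comp, Complex.ofReal_pow, sub_eq_add_neg]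
  · refine hsum.congr' ?_
    filter_upwards [eventually_gt_atTop 0] with n hn
    have : (n:ℝ) ≠ 0 := by positivity
    generalize (∑ m, av m * (2 * bConst N (αv m) * I n m)) = S
    field_simp
end
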